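/- Let u be a smooth decaying solution of ∂_t u + ∂_x u + ∂_x³ u + u ∂_x u = 0 on (0,∞)×(0,T) with u(0,t) = 0 and u(·,0) = u₀ ∈ H¹(0,∞). Then there is a constant c depending only on ‖u₀‖_{H¹(0,∞)} (explicitly c(s) = √((C²/5)s⁴ + (2/5)s³ + (12/5)s²) with C the constant of the embedding H¹(0,∞) ↪ L^∞(0,∞)) such that ‖u(·,t)‖_{H¹(0,∞)} ≤ c for all t ∈ [0,T]. -/

import Mathlib

open MeasureTheory Set Filter

noncomputable section

/-- The `H¹(0,∞)` norm of a function: `‖f‖_{H¹} = √(∫_0^∞ f² + (f')²)`. -/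
def H1norm (f : ℝ → ℝ) : ℝ :=
  Real.sqrt (∫ x in Ioi (0:ℝ), ((f x)^2 + (deriv f x)^2))

/-- `h` is the resolvent `(1 - ε ∂)⁻¹ f` on `[0, Λ]` with `h Λ = 0`. -/
structure Res (ε Λ : ℝ) (f h h1 : ℝ → ℝ) : Prop where
  hd : ∀ x, HasDerivAt h (h1 x) x
  c1 : Continuous h1
  hend : h Λ = 0
  eq : ∀ x ∈ Icc 0 Λ, h x - ε * h1 x = f x

lemma Res.cont {ε Λ : ℝ} {f h h1 : ℝ → ℝ} (H : Res ε Λ f h h1) : Continuous h :=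
  continuous_iff_continuousAt.2 fun x => (H.hd x).continuousAt

lemma intCong {Λ : ℝ} (hΛ : 0 ≤ Λ) {f g : ℝ → ℝ} (h : ∀ x ∈ Icc 0 Λ, f x = g x) :
    ∫ x in (0:ℝ)..Λ, f x = ∫ x in (0:ℝ)..Λ, g x := by
  apply intervalIntegral.integral_congr
  intro x hx
  rw [uIcc_of_le hΛ] at hx
  exact h x hx

lemma intMono {Λ : ℝ} (hΛ : 0 ≤ Λ) {f g : ℝ → ℝ} (hf : Continuous f) (hg : Continuous g)
    (h : ∀ x ∈ Icc 0 Λ, f x ≤ g x) :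
    ∫ x in (0:ℝ)..Λ, f x ≤ ∫ x in (0:ℝ)..Λ, g x :=
  intervalIntegral.integral_mono_on hΛ (hf.intervalIntegrable _ _) (hg.intervalIntegrable _ _) h

lemma intNonneg {Λ : ℝ} (hΛ : 0 ≤ Λ) {f : ℝ → ℝ} (h : ∀ x ∈ Icc 0 Λ, 0 ≤ f x) :
    0 ≤ ∫ x in (0:ℝ)..Λ, f x :=
  intervalIntegral.integral_nonneg hΛ h

lemma ftc {Λ : ℝ} {F F' : ℝ → ℝ} (h : ∀ x, HasDerivAt F (F' x) x) (hc : Continuous F') :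
    ∫ x in (0:ℝ)..Λ, F' x = F Λ - F 0 :=
  intervalIntegral.integral_eq_sub_of_hasDerivAt (fun x _ => h x) (hc.intervalIntegrable _ _)

lemma absInt {Λ : ℝ} (hΛ : 0 ≤ Λ) (f : ℝ → ℝ) :
    |∫ x in (0:ℝ)..Λ, f x| ≤ ∫ x in (0:ℝ)..Λ, |f x| :=
  intervalIntegral.abs_integral_le_integral_abs hΛ

/-- Cauchy-Schwarz. -/
lemma csInt {Λ : ℝ} (hΛ : 0 ≤ Λ) {f g : ℝ → ℝ} (hf : Continuous f) (hg : Continuous g)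
    {α β : ℝ} (hα : 0 ≤ α) (hβ : 0 ≤ β)
    (h1 : ∫ x in (0:ℝ)..Λ, (f x)^2 ≤ α^2) (h2 : ∫ x in (0:ℝ)..Λ, (g x)^2 ≤ β^2) :
    ∫ x in (0:ℝ)..Λ, |f x * g x| ≤ α * β := by
  -- for all positive a b : 2 a b |fg| ≤ a² f² + b² g²
  have key : ∀ a b : ℝ, 2 * a * b * ∫ x in (0:ℝ)..Λ, |f x * g x|
      ≤ a^2 * α^2 + b^2 * β^2 := by
    intro a b
    have h3 : ∫ x in (0:ℝ)..Λ, (2 * a * b * |f x * g x|)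
        ≤ ∫ x in (0:ℝ)..Λ, (a^2 * (f x)^2 + b^2 * (g x)^2) := by
      apply intMono hΛ (by fun_prop) (by fun_prop)
      intro x _
      rw [abs_mul]
      nlinarith [sq_nonneg (a * |f x| - b * |g x|), sq_abs (f x), sq_abs (g x)]
    rw [intervalIntegral.integral_const_mul, intervalIntegral.integral_add
      (Continuous.intervalIntegrable (by fun_prop) _ _)
      (Continuous.intervalIntegrable (by fun_prop) _ _),
      intervalIntegral.integral_const_mul, intervalIntegral.integral_const_mul] at h3
    nlinarith [mul_le_mul_of_nonneg_left h1 (sq_nonneg a),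
      mul_le_mul_of_nonneg_left h2 (sq_nonneg b)]
  set I := ∫ x in (0:ℝ)..Λ, |f x * g x| with hI
  have hI0 : 0 ≤ I := intNonneg hΛ fun x _ => abs_nonneg _
  by_contra hcon
  push Not at hcon
  -- choose a = β + δ, b = α + δ
  have hlim : ∀ δ > 0, I * ((β+δ)*(α+δ)) ≤ ((β+δ)*(α+δ)) * ((α+δ)*(β+δ)) := by
    intro δ hδ
    have := key (β+δ) (α+δ)
    have e1 : α^2 ≤ (α+δ)^2 := by nlinarith
    have e2 : β^2 ≤ (β+δ)^2 := by nlinarith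
    nlinarith [mul_le_mul_of_nonneg_left e1 (sq_nonneg (β+δ)),
      mul_le_mul_of_nonneg_left e2 (sq_nonneg (α+δ))]
  have hlim2 : ∀ δ > 0, I ≤ (α+δ)*(β+δ) := by
    intro δ hδ
    have h := hlim δ hδ
    have hp : 0 < (β+δ)*(α+δ) := by positivity
    rw [mul_comm I] at h
    exact le_of_mul_le_mul_left h hp
  have ht : Tendsto (fun δ : ℝ => (α+δ)*(β+δ)) (nhdsWithin 0 (Ioi 0)) (nhds ((α+0)*(β+0))) := by
    apply Tendsto.mono_left _ nhdsWithin_le_nhds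
    exact Continuous.tendsto (by fun_prop) 0
  have := ge_of_tendsto ht (eventually_nhdsWithin_of_forall (fun δ hδ => hlim2 δ hδ))
  simp at this
  linarith

lemma csInt' {Λ : ℝ} (hΛ : 0 ≤ Λ) {f g : ℝ → ℝ} (hf : Continuous f) (hg : Continuous g)
    {α β : ℝ} (hα : 0 ≤ α) (hβ : 0 ≤ β)
    (h1 : ∫ x in (0:ℝ)..Λ, (f x)^2 ≤ α^2) (h2 : ∫ x in (0:ℝ)..Λ, (g x)^2 ≤ β^2) :
    |∫ x in (0:ℝ)..Λ, f x * g x| ≤ α * β :=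
  (absInt hΛ _).trans (csInt hΛ hf hg hα hβ h1 h2)

lemma Res.sq {ε Λ : ℝ} (hε : 0 < ε) (hΛ : 0 ≤ Λ) {f h h1 : ℝ → ℝ} (H : Res ε Λ f h h1) :
    ∫ x in (0:ℝ)..Λ, (f x)^2 = (∫ x in (0:ℝ)..Λ, (h x)^2) + ε^2 * (∫ x in (0:ℝ)..Λ, (h1 x)^2)
      + ε * (h 0)^2 := by
  have hc := H.cont
  have hc1 := H.c1
  rw [intCong hΛ (g := fun x => ((h x)^2 + ε^2 * (h1 x)^2) - ε * (2 * h x * h1 x))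
    (fun x hx => by rw [← H.eq x hx]; ring)]
  rw [intervalIntegral.integral_sub (Continuous.intervalIntegrable (by fun_prop) _ _)
      (Continuous.intervalIntegrable (by fun_prop) _ _),
    intervalIntegral.integral_add (Continuous.intervalIntegrable (by fun_prop) _ _)
      (Continuous.intervalIntegrable (by fun_prop) _ _), intervalIntegral.integral_const_mul,
      intervalIntegral.integral_const_mul]
  have : ∫ x in (0:ℝ)..Λ, (2 * h x * h1 x) = (h Λ)^2 - (h 0)^2 := by
    refine ftc (F := fun x => (h x)^2) (fun x => ?_) (by fun_prop)
    have := (H.hd x).pow 2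
    refine this.congr_deriv ?_
    simp
  rw [this, H.hend]
  ring

lemma Res.sq_le {ε Λ : ℝ} (hε : 0 < ε) (hΛ : 0 ≤ Λ) {f h h1 : ℝ → ℝ} (H : Res ε Λ f h h1) :
    ∫ x in (0:ℝ)..Λ, (h x)^2 ≤ ∫ x in (0:ℝ)..Λ, (f x)^2 := by
  rw [H.sq hε hΛ]
  have : 0 ≤ ∫ x in (0:ℝ)..Λ, (h1 x)^2 := intNonneg hΛ fun x _ => sq_nonneg _
  have := mul_nonneg (sq_nonneg ε) this
  have := mul_nonneg hε.le (sq_nonneg (h 0))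
  linarith

/-- Comparison principle. -/
lemma comp_nonneg {ε Λ : ℝ} (hε : 0 < ε) {h h1 : ℝ → ℝ}
    (hd : ∀ x, HasDerivAt h (h1 x) x) (hend : 0 ≤ h Λ)
    (hf : ∀ x ∈ Icc 0 Λ, 0 ≤ h x - ε * h1 x) : ∀ x ∈ Icc 0 Λ, 0 ≤ h x := by
  intro x hx
  have hD : ∀ y, HasDerivAt (fun y => Real.exp (-y/ε) * h y)
      (Real.exp (-y/ε) * (-1/ε) * h y + Real.exp (-y/ε) * h1 y) y := by
    intro y
    have h2 : HasDerivAt (fun y : ℝ => -y/ε) (-1/ε) y := ((hasDerivAt_id y).neg).div_const ε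
    exact (h2.exp).mul (hd y)
  have hanti : AntitoneOn (fun y => Real.exp (-y/ε) * h y) (Icc 0 Λ) := by
    apply antitoneOn_of_deriv_nonpos (convex_Icc 0 Λ)
    · exact fun y _ => (hD y).continuousAt.continuousWithinAt
    · exact fun y _ => (hD y).differentiableAt.differentiableWithinAt
    · intro y hy
      rw [(hD y).deriv]
      have hy' := interior_subset hy
      have := hf y hy'
      have e : Real.exp (-y/ε) * (-1/ε) * h y + Real.exp (-y/ε) * h1 y
        = -(Real.exp (-y/ε) * ((h y - ε * h1 y) / ε)) := by
        field_simp; ring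
      rw [e]
      have : 0 ≤ Real.exp (-y/ε) * ((h y - ε * h1 y) / ε) := by positivity
      linarith
  have h3 := hanti hx (right_mem_Icc.2 (hx.1.trans hx.2)) hx.2
  simp only at h3
  have h4 : 0 ≤ Real.exp (-Λ/ε) * h Λ := by positivity
  have h5 : 0 ≤ Real.exp (-x/ε) * h x := h4.trans h3
  exact nonneg_of_mul_nonneg_right h5 (Real.exp_pos _)

lemma comp_abs {ε Λ : ℝ} (hε : 0 < ε) {h h1 d d1 : ℝ → ℝ}
    (hd : ∀ x, HasDerivAt h (h1 x) x) (hdd : ∀ x, HasDerivAt d (d1 x) x) (hend : |h Λ| ≤ d Λ)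
    (hf : ∀ x ∈ Icc 0 Λ, |h x - ε * h1 x| ≤ d x - ε * d1 x) : ∀ x ∈ Icc 0 Λ, |h x| ≤ d x := by
  intro x hx
  have h1' := comp_nonneg hε (h := fun x => d x - h x) (fun x => (hdd x).sub (hd x))
    (by have := (abs_le.1 hend).2; linarith)
    (fun x hx => by have := (abs_le.1 (hf x hx)).2; linarith) x hx
  have h2' := comp_nonneg hε (h := fun x => d x + h x) (fun x => (hdd x).add (hd x))
    (by have := (abs_le.1 hend).1; linarith)
    (fun x hx => by have := (abs_le.1 (hf x hx)).1; linarith) x hx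
  exact abs_le.2 ⟨by linarith, by linarith⟩

lemma Res.exists {ε Λ : ℝ} (hε : 0 < ε) {f : ℝ → ℝ} (hf : Continuous f) :
    ∃ h h1, Res ε Λ f h h1 ∧ ∀ x, h x - ε * h1 x = f x := by
  let I : ℝ → ℝ := fun x => ∫ y in Λ..x, Real.exp (-y/ε) * f y
  have hI : ∀ x, HasDerivAt I (Real.exp (-x/ε) * f x) x := fun x =>
    intervalIntegral.integral_hasDerivAt_right
      (Continuous.intervalIntegrable (by fun_prop) _ _)
      (Continuous.stronglyMeasurableAtFilter (by fun_prop) _ _)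
      (Continuous.continuousAt (by fun_prop))
  have hIc : Continuous I := continuous_iff_continuousAt.2 fun x => (hI x).continuousAt
  have hd : ∀ x, HasDerivAt (fun x => -(1/ε) * (Real.exp (x/ε) * I x))
      ((1/ε) * ((-(1/ε) * (Real.exp (x/ε) * I x)) - f x)) x := by
    intro x
    have h2 : HasDerivAt (fun y : ℝ => y/ε) (1/ε) x := (hasDerivAt_id x).div_const ε
    have h3 := ((h2.exp).mul (hI x)).const_mul (-(1/ε))
    refine h3.congr_deriv ?_
    have e : Real.exp (x/ε) * Real.exp (-x/ε) = 1 := by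
      rw [← Real.exp_add, neg_div, add_neg_cancel, Real.exp_zero]
    linear_combination (-(1/ε) * f x) * e
  refine ⟨_, _, ⟨hd, by fun_prop, by simp [I], ?_⟩, ?_⟩
  · intro x _; field_simp; ring
  · intro x; field_simp; ring

lemma Res.L1 {ε Λ : ℝ} (hε : 0 < ε) (hΛ : 0 ≤ Λ) {f h h1 : ℝ → ℝ} (H : Res ε Λ f h h1)
    (hf : Continuous f) :
    ∫ x in (0:ℝ)..Λ, |h x| ≤ ∫ x in (0:ℝ)..Λ, |f x| := by
  obtain ⟨d, d1, Hd, -⟩ := Res.exists (ε := ε) (Λ := Λ) hε hf.abs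
  have hdom := comp_abs hε H.hd Hd.hd (by rw [H.hend, Hd.hend]; simp)
    (fun x hx => by rw [H.eq x hx, Hd.eq x hx])
  have hd0 : 0 ≤ d 0 := (abs_nonneg _).trans (hdom 0 (left_mem_Icc.2 hΛ))
  have e : ∫ x in (0:ℝ)..Λ, |f x| = (∫ x in (0:ℝ)..Λ, d x) + ε * d 0 := by
    have hc := Hd.cont
    have hc1 := Hd.c1
    rw [intCong hΛ (g := fun x => d x - ε * d1 x) (fun x hx => (Hd.eq x hx).symm),
      intervalIntegral.integral_sub (Continuous.intervalIntegrable (by fun_prop) _ _)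
      (Continuous.intervalIntegrable (by fun_prop) _ _), intervalIntegral.integral_const_mul,
      ftc Hd.hd hc1, Hd.hend]
    ring
  rw [e]
  have := intMono hΛ H.cont.abs Hd.cont hdom
  have := mul_nonneg hε.le hd0
  linarith

lemma intAdd {Λ : ℝ} {f g : ℝ → ℝ} (hf : Continuous f) (hg : Continuous g) :
    ∫ x in (0:ℝ)..Λ, (f x + g x) = (∫ x in (0:ℝ)..Λ, f x) + ∫ x in (0:ℝ)..Λ, g x :=
  intervalIntegral.integral_add (hf.intervalIntegrable _ _) (hg.intervalIntegrable _ _)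

lemma intMulC {Λ : ℝ} (c : ℝ) (f : ℝ → ℝ) :
    ∫ x in (0:ℝ)..Λ, (c * f x) = c * ∫ x in (0:ℝ)..Λ, f x :=
  intervalIntegral.integral_const_mul _ _

/-- sup bound -/
lemma Res.sup {ε Λ : ℝ} (hε : 0 < ε) {f h h1 : ℝ → ℝ} (H : Res ε Λ f h h1)
    {S : ℝ} (hS : 0 ≤ S) (hf : ∀ x ∈ Icc 0 Λ, |f x| ≤ S) : ∀ x ∈ Icc 0 Λ, |h x| ≤ S :=
  comp_abs hε H.hd (fun x => hasDerivAt_const x S) (by rw [H.hend]; simpa using hS)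
    (fun x hx => by rw [H.eq x hx]; simpa using hf x hx)

/-- linear growth bound -/
lemma Res.lin {ε Λ : ℝ} (hε : 0 < ε) (hΛ : 0 ≤ Λ) {f h h1 : ℝ → ℝ} (H : Res ε Λ f h h1)
    {Q : ℝ} (hQ : 0 ≤ Q) (hf : ∀ x ∈ Icc 0 Λ, |f x| ≤ Q * x) :
    ∀ x ∈ Icc 0 Λ, |h x| ≤ Q * (x + ε) := by
  refine comp_abs hε H.hd (d1 := fun _ => Q) (fun x => ?_) ?_ ?_
  · simpa using ((hasDerivAt_id x).add_const ε).const_mul Q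
  · rw [H.hend]; simp; positivity
  · intro x hx
    rw [H.eq x hx]
    have := hf x hx
    linarith

lemma hasDerivAt_poly (ε A B C x : ℝ) :
    HasDerivAt (fun x : ℝ => A * x^3 + B * x^2 + C * x + ε) (3 * A * x^2 + 2 * B * x + C) x := by
  have h := ((((hasDerivAt_pow 3 x).const_mul A).add ((hasDerivAt_pow 2 x).const_mul B)).add
    ((hasDerivAt_id x).const_mul C)).add_const ε
  refine h.congr_deriv ?_
  norm_num; ring

lemma Res.quad {ε Λ : ℝ} (hε : 0 < ε) (hΛ : 0 ≤ Λ) {f h h1 : ℝ → ℝ} (H : Res ε Λ f h h1)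
    {Q : ℝ} (hf : ∀ x ∈ Icc 0 Λ, |f x| ≤ Q^2 * (x + ε)^2) : |h 0| ≤ 5 * Q^2 * ε^2 := by
  have := comp_abs hε H.hd (d := fun x => 0 * x^3 + Q^2 * x^2 + (4 * Q^2 * ε) * x + 5 * Q^2 * ε^2)
    (fun x => hasDerivAt_poly _ _ _ _ x) (by rw [H.hend, abs_zero]; positivity)
    (fun x hx => by
      rw [H.eq x hx]
      have := hf x hx
      linarith) 0 (left_mem_Icc.2 hΛ)
  simpa using this

/-- Taylor bound at the boundary -/
lemma Res.taylor {ε Λ : ℝ} (hε : 0 < ε) (hΛ : 1 ≤ Λ) {f h h1 : ℝ → ℝ} (H : Res ε Λ f h h1)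
    {p K B : ℝ} (hK : 0 ≤ K) (hB : |p| ≤ B)
    (hf : ∀ x ∈ Icc 0 Λ, |f x - p * x| ≤ K * x^2 + B * x^3) :
    |h 0 - p * ε| ≤ 2 * K * ε^2 + 6 * B * ε^3 := by
  have hB0 : 0 ≤ B := (abs_nonneg _).trans hB
  have := comp_abs hε (h := fun x => h x - p * (x + ε)) (h1 := fun x => h1 x - p)
    (d := fun x => B * x^3 + (K + 3 * ε * B) * x^2 + (2 * ε * K + 6 * ε^2 * B) * x
      + (2 * K * ε^2 + 6 * B * ε^3)) (Λ := Λ)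
    (fun x => by
      have := (H.hd x).sub (((hasDerivAt_id x).add_const ε).const_mul p)
      exact this.congr_deriv (by simp))
    (fun x => hasDerivAt_poly _ _ _ _ x) (by
      simp only [H.hend, zero_sub, abs_neg, abs_mul]
      rw [abs_of_nonneg (by positivity : (0:ℝ) ≤ Λ + ε)]
      have e1 : Λ ≤ Λ^3 := by nlinarith [sq_nonneg (Λ-1), sq_nonneg Λ, mul_nonneg (sub_nonneg.2 hΛ) (sq_nonneg Λ)]
      have e2 : ε ≤ 3 * ε * Λ^2 := by nlinarith
      have e3 : |p| * (Λ + ε) ≤ B * (Λ^3 + 3 * ε * Λ^2) := by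
        apply mul_le_mul hB (by linarith) (by positivity) hB0
      have e4 : 0 ≤ K * Λ^2 + (2 * ε * K + 6 * ε^2 * B) * Λ
        + (2 * K * ε^2 + 6 * B * ε^3) := by positivity
      linarith)
    (fun x hx => by
      have e : h x - p * (x + ε) - ε * (h1 x - p) = f x - p * x := by
        rw [← H.eq x hx]; ring
      rw [e]
      have := hf x hx
      linarith) 0 (left_mem_Icc.2 (by linarith))
  simpa using this

/-- A bundle of static data. -/
structure Core (ε Λ Q η : ℝ) (U U1 U2 U3 w w1 w2 w3 z z1 z2 z3 r r1 g g1 s s1 f1 f2 f21 : ℝ → ℝ) :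
    Prop where
  hε : 0 < ε
  hε1 : ε ≤ 1
  hΛ : 1 ≤ Λ
  hQ : 1 ≤ Q
  hη : 0 ≤ η
  dU : ∀ x, HasDerivAt U (U1 x) x
  dU1 : ∀ x, HasDerivAt U1 (U2 x) x
  dU2 : ∀ x, HasDerivAt U2 (U3 x) x
  cU3 : Continuous U3
  U0 : U 0 = 0
  UL : U Λ = 0
  U1L : U1 Λ = 0
  U2L : U2 Λ = 0
  W : Res ε Λ U w w1
  W1 : Res ε Λ U1 w1 w2
  W2 : Res ε Λ U2 w2 w3
  Z : Res ε Λ (fun x => (w x)^2) z z1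
  Z1 : Res ε Λ (fun x => 2 * w x * w1 x) z1 z2
  Z2 : Res ε Λ (fun x => 2 * (w1 x)^2 + 2 * w x * w2 x) z2 z3
  R : Res ε Λ (fun x => (w1 x)^2) r r1
  df2 : ∀ x, HasDerivAt f2 (f21 x) x
  cf21 : Continuous f21
  cf1 : Continuous f1
  f2L : f2 Λ = 0
  G : Res ε Λ (fun x => f1 x + f21 x) g g1
  S : Res ε Λ (fun x => w x * (w x * w1 x + ε^2/2 * r1 x - g x)) s s1
  bU : ∫ x in (0:ℝ)..Λ, (U x)^2 ≤ Q^2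
  bU1 : ∫ x in (0:ℝ)..Λ, (U1 x)^2 ≤ Q^2
  sU : ∀ x ∈ Icc 0 Λ, |U x| ≤ Q
  lU : ∀ x ∈ Icc 0 Λ, |U x| ≤ Q * x
  pU : |U1 0| ≤ Q
  bf1 : ∫ x in (0:ℝ)..Λ, (f1 x)^2 ≤ η^2
  bf2 : ∫ x in (0:ℝ)..Λ, (f2 x)^2 ≤ η^2

namespace Core
variable {ε Λ Q η : ℝ}
  {U U1 U2 U3 w w1 w2 w3 z z1 z2 z3 r r1 g g1 s s1 f1 f2 f21 : ℝ → ℝ}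

lemma L0 (H : Core ε Λ Q η U U1 U2 U3 w w1 w2 w3 z z1 z2 z3 r r1 g g1 s s1 f1 f2 f21) :
    0 ≤ Λ := by have := H.hΛ; linarith
lemma Q0 (H : Core ε Λ Q η U U1 U2 U3 w w1 w2 w3 z z1 z2 z3 r r1 g g1 s s1 f1 f2 f21) :
    0 ≤ Q := by have := H.hQ; linarith
lemma cU (H : Core ε Λ Q η U U1 U2 U3 w w1 w2 w3 z z1 z2 z3 r r1 g g1 s s1 f1 f2 f21) :
    Continuous U := continuous_iff_continuousAt.2 fun x => (H.dU x).continuousAt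
lemma cU1 (H : Core ε Λ Q η U U1 U2 U3 w w1 w2 w3 z z1 z2 z3 r r1 g g1 s s1 f1 f2 f21) :
    Continuous U1 := continuous_iff_continuousAt.2 fun x => (H.dU1 x).continuousAt
lemma cU2 (H : Core ε Λ Q η U U1 U2 U3 w w1 w2 w3 z z1 z2 z3 r r1 g g1 s s1 f1 f2 f21) :
    Continuous U2 := continuous_iff_continuousAt.2 fun x => (H.dU2 x).continuousAt
lemma cf2 (H : Core ε Λ Q η U U1 U2 U3 w w1 w2 w3 z z1 z2 z3 r r1 g g1 s s1 f1 f2 f21) :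
    Continuous f2 := continuous_iff_continuousAt.2 fun x => (H.df2 x).continuousAt

lemma sw (H : Core ε Λ Q η U U1 U2 U3 w w1 w2 w3 z z1 z2 z3 r r1 g g1 s s1 f1 f2 f21) :
    ∀ x ∈ Icc 0 Λ, |w x| ≤ Q := H.W.sup H.hε H.Q0 H.sU
lemma bw (H : Core ε Λ Q η U U1 U2 U3 w w1 w2 w3 z z1 z2 z3 r r1 g g1 s s1 f1 f2 f21) :
    ∫ x in (0:ℝ)..Λ, (w x)^2 ≤ Q^2 := (H.W.sq_le H.hε H.L0).trans H.bU
lemma bw1 (H : Core ε Λ Q η U U1 U2 U3 w w1 w2 w3 z z1 z2 z3 r r1 g g1 s s1 f1 f2 f21) :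
    ∫ x in (0:ℝ)..Λ, (w1 x)^2 ≤ Q^2 := (H.W1.sq_le H.hε H.L0).trans H.bU1
lemma lw (H : Core ε Λ Q η U U1 U2 U3 w w1 w2 w3 z z1 z2 z3 r r1 g g1 s s1 f1 f2 f21) :
    ∀ x ∈ Icc 0 Λ, |w x| ≤ Q * (x + ε) := H.W.lin H.hε H.L0 H.Q0 H.lU
lemma w0 (H : Core ε Λ Q η U U1 U2 U3 w w1 w2 w3 z z1 z2 z3 r r1 g g1 s s1 f1 f2 f21) :
    |w 0| ≤ Q * ε := by simpa using H.lw 0 (left_mem_Icc.2 H.L0)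
lemma w10 (H : Core ε Λ Q η U U1 U2 U3 w w1 w2 w3 z z1 z2 z3 r r1 g g1 s s1 f1 f2 f21) :
    ε * w1 0 = w 0 := by
  have := H.W.eq 0 (left_mem_Icc.2 H.L0)
  rw [H.U0] at this; linarith
lemma w20 (H : Core ε Λ Q η U U1 U2 U3 w w1 w2 w3 z z1 z2 z3 r r1 g g1 s s1 f1 f2 f21) :
    ε * w2 0 = w1 0 - U1 0 := by
  have := H.W1.eq 0 (left_mem_Icc.2 H.L0)
  linarith
lemma sz (H : Core ε Λ Q η U U1 U2 U3 w w1 w2 w3 z z1 z2 z3 r r1 g g1 s s1 f1 f2 f21) :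
    ∀ x ∈ Icc 0 Λ, |z x| ≤ Q^2 := H.Z.sup H.hε (sq_nonneg _) fun x hx => by
      rw [abs_of_nonneg (sq_nonneg _), ← sq_abs]
      exact pow_le_pow_left₀ (abs_nonneg _) (H.sw x hx) 2
lemma z0 (H : Core ε Λ Q η U U1 U2 U3 w w1 w2 w3 z z1 z2 z3 r r1 g g1 s s1 f1 f2 f21) :
    |z 0| ≤ 5 * Q^2 * ε^2 := H.Z.quad H.hε H.L0 fun x hx => by
      rw [abs_of_nonneg (sq_nonneg _), ← sq_abs, ← mul_pow]
      exact pow_le_pow_left₀ (abs_nonneg _) (H.lw x hx) 2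
lemma z0n (H : Core ε Λ Q η U U1 U2 U3 w w1 w2 w3 z z1 z2 z3 r r1 g g1 s s1 f1 f2 f21) :
    0 ≤ z 0 := comp_nonneg H.hε H.Z.hd H.Z.hend.ge (fun x hx => by
      rw [H.Z.eq x hx]; positivity) 0 (left_mem_Icc.2 H.L0)
lemma rn (H : Core ε Λ Q η U U1 U2 U3 w w1 w2 w3 z z1 z2 z3 r r1 g g1 s s1 f1 f2 f21) :
    ∀ x ∈ Icc 0 Λ, 0 ≤ r x := comp_nonneg H.hε H.R.hd H.R.hend.ge (fun x hx => by
      rw [H.R.eq x hx]; positivity)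
lemma bsq (H : Core ε Λ Q η U U1 U2 U3 w w1 w2 w3 z z1 z2 z3 r r1 g g1 s s1 f1 f2 f21)
    {f h : ℝ → ℝ} (hf : Continuous f) (hh : Continuous h) {c A : ℝ}
    (hA : ∫ x in (0:ℝ)..Λ, (f x)^2 ≤ A^2)
    (hb : ∀ x ∈ Icc 0 Λ, |h x| ≤ c * |f x|) :
    ∫ x in (0:ℝ)..Λ, (h x)^2 ≤ (c * A)^2 := by
  have : ∫ x in (0:ℝ)..Λ, (h x)^2 ≤ ∫ x in (0:ℝ)..Λ, c^2 * (f x)^2 := by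
    apply intMono H.L0 (by fun_prop) (by fun_prop)
    intro x hx
    rw [← mul_pow, ← sq_abs (h x)]
    calc |h x|^2 ≤ (c * |f x|)^2 := pow_le_pow_left₀ (abs_nonneg _) (hb x hx) 2
      _ = (c * f x)^2 := by rw [mul_pow, sq_abs, mul_pow]
  rw [intMulC] at this
  nlinarith [mul_le_mul_of_nonneg_left hA (sq_nonneg c)]
lemma bww1 (H : Core ε Λ Q η U U1 U2 U3 w w1 w2 w3 z z1 z2 z3 r r1 g g1 s s1 f1 f2 f21) :
    ∫ x in (0:ℝ)..Λ, (w x * w1 x)^2 ≤ (Q * Q)^2 := by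
  have := H.W.cont
  have := H.W1.cont
  refine H.bsq (f := w1) (by fun_prop) (by fun_prop) H.bw1 fun x hx => ?_
  rw [abs_mul]
  exact mul_le_mul_of_nonneg_right (H.sw x hx) (abs_nonneg _)
lemma bz (H : Core ε Λ Q η U U1 U2 U3 w w1 w2 w3 z z1 z2 z3 r r1 g g1 s s1 f1 f2 f21) :
    ∫ x in (0:ℝ)..Λ, (z x)^2 ≤ (Q * Q)^2 := by
  have := H.W.cont
  refine (H.Z.sq_le H.hε H.L0).trans (H.bsq (f := w) (by fun_prop) (by fun_prop) H.bw
    fun x hx => ?_)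
  rw [abs_of_nonneg (sq_nonneg _), ← sq_abs, sq]
  exact mul_le_mul_of_nonneg_right (H.sw x hx) (abs_nonneg _)
lemma bz1 (H : Core ε Λ Q η U U1 U2 U3 w w1 w2 w3 z z1 z2 z3 r r1 g g1 s s1 f1 f2 f21) :
    ∫ x in (0:ℝ)..Λ, (z1 x)^2 ≤ (2 * Q * Q)^2 := by
  have := H.W.cont
  have := H.W1.cont
  refine (H.Z1.sq_le H.hε H.L0).trans (H.bsq (f := w1) (by fun_prop) (by fun_prop) H.bw1
    fun x hx => ?_)
  rw [abs_mul, abs_mul, abs_two]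
  have := mul_le_mul_of_nonneg_right (H.sw x hx) (abs_nonneg (w1 x))
  nlinarith
lemma br (H : Core ε Λ Q η U U1 U2 U3 w w1 w2 w3 z z1 z2 z3 r r1 g g1 s s1 f1 f2 f21) :
    ∫ x in (0:ℝ)..Λ, |r x - (w1 x)^2| ≤ 2 * Q^2 := by
  have := H.W1.cont
  have := H.R.cont
  have h1 := H.R.L1 H.hε H.L0 (by fun_prop)
  have h2 : ∫ x in (0:ℝ)..Λ, |(w1 x)^2| ≤ Q^2 := by
    simpa using H.bw1
  have h3 : ∫ x in (0:ℝ)..Λ, |r x - (w1 x)^2| ≤ ∫ x in (0:ℝ)..Λ, (|r x| + |(w1 x)^2|) := by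
    apply intMono H.L0 (by fun_prop) (by fun_prop)
    intro x _
    exact abs_sub _ _
  rw [intAdd (by fun_prop) (by fun_prop)] at h3
  linarith
lemma bg (H : Core ε Λ Q η U U1 U2 U3 w w1 w2 w3 z z1 z2 z3 r r1 g g1 s s1 f1 f2 f21) :
    ∫ x in (0:ℝ)..Λ, (g x)^2 ≤ (4 * η / ε)^2 := by
  have hε := H.hε
  have c1 := H.cf1
  have c2 := H.cf2
  have c3 := H.cf21
  have c4 := H.G.cont
  have c5 := H.G.c1
  have T : Res ε Λ (fun x => f1 x + f2 x / ε) (fun x => g x + f2 x / ε)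
      (fun x => g1 x + f21 x / ε) := by
    refine ⟨fun x => (H.G.hd x).add ((H.df2 x).div_const ε), by fun_prop, by
      simp [H.G.hend, H.f2L], fun x hx => ?_⟩
    have := H.G.eq x hx
    field_simp
    linear_combination ε * this
  have h1 := T.sq_le hε H.L0
  have hee : 1 ≤ 1/ε^2 := by
    rw [le_div_iff₀ (by positivity)]
    have := H.hε1
    nlinarith
  have h2 : ∫ x in (0:ℝ)..Λ, (f1 x + f2 x / ε)^2
      ≤ ∫ x in (0:ℝ)..Λ, (2 * (f1 x)^2 + 2/ε^2 * (f2 x)^2) := by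
    apply intMono H.L0 (by fun_prop) (by fun_prop)
    intro x _
    have : 2/ε^2 * (f2 x)^2 = 2 * (f2 x/ε)^2 := by field_simp
    rw [this]
    nlinarith [sq_nonneg (f1 x - f2 x / ε)]
  rw [intAdd (by fun_prop) (by fun_prop), intMulC, intMulC] at h2
  have h3 : ∫ x in (0:ℝ)..Λ, (g x)^2
      ≤ ∫ x in (0:ℝ)..Λ, (2 * (g x + f2 x / ε)^2 + 2/ε^2 * (f2 x)^2) := by
    apply intMono H.L0 (by fun_prop) (by fun_prop)
    intro x _
    have : 2/ε^2 * (f2 x)^2 = 2 * (f2 x/ε)^2 := by field_simp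
    rw [this]
    nlinarith [sq_nonneg (g x + 2 * (f2 x / ε))]
  rw [intAdd (by fun_prop) (by fun_prop), intMulC, intMulC] at h3
  have e1 : 2/ε^2 * ∫ x in (0:ℝ)..Λ, (f2 x)^2 ≤ 2/ε^2 * η^2 :=
    mul_le_mul_of_nonneg_left H.bf2 (by positivity)
  have e2 := H.bf1
  have e3 : η^2 ≤ 1/ε^2 * η^2 := le_mul_of_one_le_left (sq_nonneg _) hee
  have e4 : (4 * η / ε)^2 = 16 * (1/ε^2 * η^2) := by field_simp; ring
  have e5 : 2/ε^2 * η^2 = 2 * (1/ε^2 * η^2) := by ring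
  rw [e4]
  linarith [sq_nonneg (η/ε), (by positivity : 0 ≤ 1/ε^2 * η^2)]
end Core

namespace Core
variable {ε Λ Q η : ℝ}
  {U U1 U2 U3 w w1 w2 w3 z z1 z2 z3 r r1 g g1 s s1 f1 f2 f21 : ℝ → ℝ}

lemma r1eq (H : Core ε Λ Q η U U1 U2 U3 w w1 w2 w3 z z1 z2 z3 r r1 g g1 s s1 f1 f2 f21) :
    ∀ x ∈ Icc 0 Λ, ε^2/2 * r1 x = ε/2 * (r x - (w1 x)^2) := by
  intro x hx
  rw [← H.R.eq x hx]; ring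

lemma iw3w1 (H : Core ε Λ Q η U U1 U2 U3 w w1 w2 w3 z z1 z2 z3 r r1 g g1 s s1 f1 f2 f21) :
    |∫ x in (0:ℝ)..Λ, (w x)^3 * w1 x| ≤ Q^4 * ε := by
  have c1 := H.W.cont
  have c2 := H.W1.cont
  have e : ∫ x in (0:ℝ)..Λ, (w x)^3 * w1 x = 1/4 * (w Λ)^4 - 1/4 * (w 0)^4 := by
    refine ftc (F := fun x => 1/4 * (w x)^4) (fun x => ?_) (by fun_prop)
    refine (((H.W.hd x).pow 4).const_mul (1/4)).congr_deriv ?_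
    norm_num; ring
  rw [e, H.W.hend]
  have hq := H.Q0
  have he := H.hε
  have : |w 0|^4 ≤ (Q * ε)^4 := pow_le_pow_left₀ (abs_nonneg _) H.w0 4
  have h2 : (Q * ε)^4 ≤ Q^4 * ε := by
    rw [mul_pow]
    apply mul_le_mul_of_nonneg_left _ (by positivity)
    calc ε^4 ≤ ε^1 := pow_le_pow_of_le_one he.le H.hε1 (by norm_num)
      _ = ε := pow_one _
  have h3 : |w 0|^4 = (w 0)^4 := by
    rw [show |w 0|^4 = (|w 0|^2)^2 by ring, sq_abs]; ring
  rw [h3] at this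
  have h4 : 0 ≤ (w 0)^4 := by positivity
  rw [abs_le]
  constructor <;> norm_num <;> nlinarith

/-- L¹ bound of the remainder -/
lemma bf (H : Core ε Λ Q η U U1 U2 U3 w w1 w2 w3 z z1 z2 z3 r r1 g g1 s s1 f1 f2 f21) :
    ∫ x in (0:ℝ)..Λ, |ε/2 * (r x - (w1 x)^2)| ≤ ε * Q^2 := by
  have he := H.hε
  have e : ∀ x, |ε/2 * (r x - (w1 x)^2)| = ε/2 * |r x - (w1 x)^2| := fun x => by
    rw [abs_mul, abs_of_nonneg (by positivity)]
  simp only [e]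
  rw [intMulC]
  have := mul_le_mul_of_nonneg_left H.br (by positivity : 0 ≤ ε/2)
  linarith

lemma intSupMul (H : Core ε Λ Q η U U1 U2 U3 w w1 w2 w3 z z1 z2 z3 r r1 g g1 s s1 f1 f2 f21)
    {h f : ℝ → ℝ} (ch : Continuous h) (cf : Continuous f) {A B : ℝ} (hA : 0 ≤ A)
    (hh : ∀ x ∈ Icc 0 Λ, |h x| ≤ A) (hB : ∫ x in (0:ℝ)..Λ, |f x| ≤ B) :
    |∫ x in (0:ℝ)..Λ, h x * f x| ≤ A * B := by
  refine (absInt H.L0 _).trans ?_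
  have : ∫ x in (0:ℝ)..Λ, |h x * f x| ≤ ∫ x in (0:ℝ)..Λ, A * |f x| := by
    apply intMono H.L0 (by fun_prop) (by fun_prop)
    intro x hx
    rw [abs_mul]
    exact mul_le_mul_of_nonneg_right (hh x hx) (abs_nonneg _)
  rw [intMulC] at this
  exact this.trans (mul_le_mul_of_nonneg_left hB hA)

lemma zk (H : Core ε Λ Q η U U1 U2 U3 w w1 w2 w3 z z1 z2 z3 r r1 g g1 s s1 f1 f2 f21) :
    |∫ x in (0:ℝ)..Λ, z x * (w x * w1 x + ε^2/2 * r1 x - g x)|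
      ≤ 4 * Q^4 * ε + Q^2 * (4 * η / ε) := by
  have c1 := H.W.cont
  have c2 := H.W1.cont
  have c3 := H.Z.cont
  have c4 := H.Z1.cont
  have c5 := H.R.cont
  have c6 := H.G.cont
  have hε := H.hε
  have hη := H.hη
  have hQ := H.Q0
  rw [intCong H.L0 (g := fun x => (w x)^3 * w1 x + (ε * (z1 x * (w x * w1 x)) +
    (z x * (ε/2 * (r x - (w1 x)^2)) + (-1) * (z x * g x)))) (fun x hx => by
      rw [H.r1eq x hx]
      have := H.Z.eq x hx
      linear_combination (w x * w1 x) * this)]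
  rw [intAdd (by fun_prop) (by fun_prop), intAdd (by fun_prop) (by fun_prop),
    intAdd (by fun_prop) (by fun_prop), intMulC, intMulC]
  have a1 := H.iw3w1
  have a2 := csInt' H.L0 c4 (by fun_prop) (by positivity) (by positivity) H.bz1 H.bww1
  have a3 := H.intSupMul (h := z) (f := fun x => ε/2 * (r x - (w1 x)^2)) c3 (by fun_prop)
    (by positivity) H.sz H.bf
  have a4 := csInt' H.L0 c3 c6 (by positivity) (by positivity) H.bz H.bg
  refine (abs_add_le _ _).trans ?_
  refine (add_le_add_right (abs_add_le _ _) _).trans ?_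
  refine (add_le_add_right (add_le_add_right (abs_add_le _ _) _) _).trans ?_
  rw [abs_mul, abs_mul, abs_of_pos hε]
  have a2' := mul_le_mul_of_nonneg_left a2 hε.le
  norm_num
  calc _ ≤ Q^4 * ε + (ε * (2 * Q * Q * (Q * Q)) + (Q^2 * (ε * Q^2) + Q * Q * (4 * η / ε))) := by
        gcongr
    _ = _ := by ring

lemma ws (H : Core ε Λ Q η U U1 U2 U3 w w1 w2 w3 z z1 z2 z3 r r1 g g1 s s1 f1 f2 f21) :
    |∫ x in (0:ℝ)..Λ, w x * s x|
      ≤ 4 * Q^4 * ε + Q^2 * (4 * η / ε) := by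
  have c1 := H.W.cont
  have c2 := H.W1.cont
  have c5 := H.R.cont
  have c6 := H.G.cont
  have c7 := H.S.cont
  have c8 := H.S.c1
  have c9 := H.R.c1
  have hε := H.hε
  have hη := H.hη
  have hQ := H.Q0
  obtain ⟨n, n1, N, Neq⟩ := Res.exists (ε := ε) (Λ := Λ) hε (f := fun x => (w x)^3) (by fun_prop)
  have cn := N.cont
  have cn1 := N.c1
  have n1e : n1 = fun x => (n x - (w x)^3) / ε := by
    funext x; have := Neq x; field_simp; linarith
  -- n1 is itself a resolvent
  have N1 : Res ε Λ (fun x => 3 * (w x)^2 * w1 x) n1 (fun x => (n1 x - 3 * (w x)^2 * w1 x)/ε) := by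
    refine ⟨fun x => ?_, by fun_prop, ?_, fun x _ => by field_simp; ring⟩
    · have h := ((N.hd x).sub ((H.W.hd x).pow 3)).div_const ε
      have h' := h.congr_deriv (g' := (n1 x - 3 * (w x)^2 * w1 x)/ε) (by norm_num)
      rw [n1e] at h' ⊢
      exact h'
    · rw [n1e]; simp [N.hend, H.W.hend]
  have S2 : Res ε Λ (fun x => w x * (ε^2/2 * r1 x) - w x * g x) (fun x => s x - n1 x / 3)
      (fun x => s1 x - ((n1 x - 3 * (w x)^2 * w1 x)/ε) / 3) := by
    refine ⟨fun x => (H.S.hd x).sub ((N1.hd x).div_const 3), by fun_prop, ?_, fun x hx => ?_⟩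
    · simp [H.S.hend, N1.hend]
    · have e1 := H.S.eq x hx
      have e2 := N1.eq x hx
      linear_combination e1 - e2 / 3
  have l1 := S2.L1 hε H.L0 (by fun_prop)
  have l2 : ∫ x in (0:ℝ)..Λ, |w x * (ε^2/2 * r1 x) - w x * g x| ≤ Q * (ε * Q^2) + Q * (4 * η/ε) := by
    rw [intCong H.L0 (g := fun x => |w x * (ε/2 * (r x - (w1 x)^2)) - w x * g x|) (fun x hx => by
      rw [H.r1eq x hx])]
    have : ∫ x in (0:ℝ)..Λ, |w x * (ε/2 * (r x - (w1 x)^2)) - w x * g x|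
      ≤ ∫ x in (0:ℝ)..Λ, (Q * |ε/2 * (r x - (w1 x)^2)| + |w x * g x|) := by
      apply intMono H.L0 (by fun_prop) (by fun_prop)
      intro x hx
      refine (abs_sub _ _).trans ?_
      rw [abs_mul (w x) (ε/2 * _)]
      have := mul_le_mul_of_nonneg_right (H.sw x hx) (abs_nonneg (ε/2 * (r x - (w1 x)^2)))
      linarith
    rw [intAdd (by fun_prop) (by fun_prop), intMulC] at this
    have a4 := csInt H.L0 c1 c6 hQ (by positivity) H.bw H.bg
    have := mul_le_mul_of_nonneg_left H.bf hQ
    linarith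
  have l3 := H.intSupMul (h := w) (f := fun x => s x - n1 x/3) c1 (by fun_prop) hQ H.sw (l1.trans l2)
  -- the main part
  have sn : |n 0| ≤ Q^3 := N.sup hε (by positivity) (fun x hx => by
    rw [abs_pow]; exact pow_le_pow_left₀ (abs_nonneg _) (H.sw x hx) 3) 0 (left_mem_Icc.2 H.L0)
  have m1 : ∫ x in (0:ℝ)..Λ, (w1 x * n x + w x * n1 x) = w Λ * n Λ - w 0 * n 0 :=
    ftc (F := fun x => w x * n x) (fun x => (H.W.hd x).mul (N.hd x)) (by fun_prop)
  rw [intAdd (by fun_prop) (by fun_prop), N.hend] at m1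
  have m2 : ∫ x in (0:ℝ)..Λ, w1 x * n x = (∫ x in (0:ℝ)..Λ, (w x)^3 * w1 x)
      + ε * ∫ x in (0:ℝ)..Λ, w1 x * n1 x := by
    rw [intCong H.L0 (g := fun x => (w x)^3 * w1 x + ε * (w1 x * n1 x)) (fun x hx => by
      have := N.eq x hx
      linear_combination w1 x * this), intAdd (by fun_prop) (by fun_prop), intMulC]
  have bn1 : ∫ x in (0:ℝ)..Λ, (n1 x)^2 ≤ ((3 * Q^2) * Q)^2 :=
    (N1.sq_le hε H.L0).trans (H.bsq (f := w1) (by fun_prop) (by fun_prop) H.bw1 fun x hx => by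
      rw [abs_mul, abs_mul, abs_pow]
      have := pow_le_pow_left₀ (abs_nonneg _) (H.sw x hx) 2
      rw [show |(3:ℝ)| = 3 by norm_num]
      exact mul_le_mul_of_nonneg_right (by linarith) (abs_nonneg _))
  have m3 := csInt' H.L0 c2 cn1 hQ (by positivity) H.bw1 bn1
  have m4 := H.iw3w1
  have m5 : |w 0 * n 0| ≤ Q * ε * Q^3 := by
    rw [abs_mul]; exact mul_le_mul H.w0 sn (abs_nonneg _) (by positivity)
  have e : ∫ x in (0:ℝ)..Λ, w x * s x = (∫ x in (0:ℝ)..Λ, w x * (s x - n1 x/3))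
      + 1/3 * ∫ x in (0:ℝ)..Λ, w x * n1 x := by
    rw [← intMulC, ← intAdd (by fun_prop) (by fun_prop)]
    exact intCong H.L0 fun x _ => by ring
  have m3' := mul_le_mul_of_nonneg_left m3 hε.le
  rw [← abs_of_pos hε, ← abs_mul, abs_of_pos hε] at m3'
  rw [e]
  have f1 := abs_le.1 l3
  have f2 := abs_le.1 m3'
  have f3 := abs_le.1 m4
  have f4 := abs_le.1 m5
  rw [abs_le]
  have q1 : Q * (Q * (ε * Q^2) + Q * (4 * η/ε)) = Q^4 * ε + Q^2 * (4 * η/ε) := by ring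
  have q2 : ε * (Q * (3 * Q^2 * Q)) = 3 * (Q^4 * ε) := by ring
  have q3 : Q * ε * Q^3 = Q^4 * ε := by ring
  rw [q1] at f1
  rw [q2] at f2
  rw [q3] at f4
  constructor <;> nlinarith
end Core

namespace Core
variable {ε Λ Q η : ℝ}
  {U U1 U2 U3 w w1 w2 w3 z z1 z2 z3 r r1 g g1 s s1 f1 f2 f21 : ℝ → ℝ}

lemma massRate (H : Core ε Λ Q η U U1 U2 U3 w w1 w2 w3 z z1 z2 z3 r r1 g g1 s s1 f1 f2 f21)
    {Ut : ℝ → ℝ}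
    (hU : ∀ x ∈ Icc 0 Λ, Ut x = - U1 x - U3 x - U x * U1 x + f1 x + f21 x) :
    |(∫ x in (0:ℝ)..Λ, 2 * U x * Ut x) + (U1 0)^2| ≤ 4 * Q * η := by
  have c1 := H.cU
  have c2 := H.cU1
  have c3 := H.cU2
  have c4 := H.cU3
  have c5 := H.cf1
  have c6 := H.cf2
  have c7 := H.cf21
  have hη := H.hη
  have hQ := H.Q0
  rw [intCong H.L0 (g := fun x => (-2 * (U x * U1 x) - 2 * (U x * U3 x) - 2 * ((U x)^2 * U1 x)
    + 2 * (U1 x * f2 x + U x * f21 x)) + (2 * (U x * f1 x) + (-2) * (U1 x * f2 x)))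
    (fun x hx => by rw [hU x hx]; ring)]
  rw [intAdd (by fun_prop) (by fun_prop), intAdd (f := fun x => 2 * (U x * f1 x)) (by fun_prop) (by fun_prop), intMulC, intMulC]
  have e : ∫ x in (0:ℝ)..Λ, (-2 * (U x * U1 x) - 2 * (U x * U3 x) - 2 * ((U x)^2 * U1 x)
    + 2 * (U1 x * f2 x + U x * f21 x)) = - (U1 0)^2 := by
    rw [ftc (F := fun x => -(U x)^2 - 2 * (U x * U2 x) + (U1 x)^2 - 2/3 * (U x)^3 + 2 * (U x * f2 x))
      (fun x => ?_) (by fun_prop)]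
    · simp only [H.UL, H.U1L, H.U0, H.f2L]; ring
    · refine ((((((H.dU x).pow 2).neg.sub (((H.dU x).mul (H.dU2 x)).const_mul 2)).add
        ((H.dU1 x).pow 2)).sub (((H.dU x).pow 3).const_mul (2/3))).add
        (((H.dU x).mul (H.df2 x)).const_mul 2)).congr_deriv ?_
      norm_num; ring
  rw [e]
  have a1 := csInt' H.L0 c1 c5 hQ hη H.bU H.bf1
  have a2 := csInt' H.L0 c2 c6 hQ hη H.bU1 H.bf2
  rw [abs_le] at *
  constructor <;> linarith

lemma energyRate (H : Core ε Λ Q η U U1 U2 U3 w w1 w2 w3 z z1 z2 z3 r r1 g g1 s s1 f1 f2 f21)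
    {wt zt : ℝ → ℝ}
    (hw : ∀ x ∈ Icc 0 Λ, wt x = - w1 x - w3 x - (w x * w1 x + ε^2/2 * r1 x - g x))
    (hz : ∀ x ∈ Icc 0 Λ, zt x = - z1 x - z3 x + 3 * r1 x - 2 * s x) :
    ∫ x in (0:ℝ)..Λ, (2 * w x * wt x + ε^2/3 * (z x * wt x + w x * zt x))
      = (w 0)^2 + 2 * (w 0 * w2 0) - (w1 0)^2 + 2/3 * (w 0)^3 + 2 * (∫ x in (0:ℝ)..Λ, w x * g x)
        + ε^2/3 * (z 0 * w 0 + z 0 * w2 0 - z1 0 * w1 0 + z2 0 * w 0)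
        - ε^2/3 * ((∫ x in (0:ℝ)..Λ, z x * (w x * w1 x + ε^2/2 * r1 x - g x))
          + 2 * ∫ x in (0:ℝ)..Λ, w x * s x) := by
  have c1 := H.W.cont
  have c2 := H.W1.cont
  have c3 := H.W2.cont
  have c4 := H.W2.c1
  have d1 := H.Z.cont
  have d2 := H.Z1.cont
  have d3 := H.Z2.cont
  have d4 := H.Z2.c1
  have d5 := H.R.c1
  have d6 := H.G.cont
  have d7 := H.S.cont
  rw [intCong H.L0 (g := fun x => (-2 * (w x * w1 x) - 2 * (w x * w3 x) - 2 * ((w x)^2 * w1 x)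
    - ε^2/3 * (z1 x * w x + z x * w1 x) - ε^2/3 * (z x * w3 x + z3 x * w x))
    + (2 * (w x * g x) + (-(ε^2/3) * (z x * (w x * w1 x + ε^2/2 * r1 x - g x))
      + (-(ε^2/3) * 2) * (w x * s x))))
    (fun x hx => by rw [hw x hx, hz x hx]; ring)]
  rw [intAdd (by fun_prop) (by fun_prop), intAdd (f := fun x => 2 * (w x * g x)) (by fun_prop)
    (by fun_prop), intAdd (by fun_prop) (by fun_prop), intMulC, intMulC, intMulC]
  rw [ftc (F := fun x => -(w x)^2 - 2 * (w x * w2 x) + (w1 x)^2 - 2/3 * (w x)^3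
    - ε^2/3 * (z x * w x) - ε^2/3 * (z x * w2 x - z1 x * w1 x + z2 x * w x)) (fun x => ?_) (by fun_prop)]
  · simp only [H.W.hend, H.W1.hend, H.Z.hend]; ring
  · refine (((((((H.W.hd x).pow 2).neg.sub (((H.W.hd x).mul (H.W2.hd x)).const_mul 2)).add
        ((H.W1.hd x).pow 2)).sub (((H.W.hd x).pow 3).const_mul (2/3))).sub
        (((H.Z.hd x).mul (H.W.hd x)).const_mul (ε^2/3))).sub
        (((((H.Z.hd x).mul (H.W2.hd x)).sub ((H.Z1.hd x).mul (H.W1.hd x))).add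
          ((H.Z2.hd x).mul (H.W.hd x))).const_mul (ε^2/3))).congr_deriv ?_
    norm_num; ring

set_option maxHeartbeats 2000000 in
lemma finalRate (H : Core ε Λ Q η U U1 U2 U3 w w1 w2 w3 z z1 z2 z3 r r1 g g1 s s1 f1 f2 f21)
    {Ut wt zt : ℝ → ℝ}
    (hU : ∀ x ∈ Icc 0 Λ, Ut x = - U1 x - U3 x - U x * U1 x + f1 x + f21 x)
    (hw : ∀ x ∈ Icc 0 Λ, wt x = - w1 x - w3 x - (w x * w1 x + ε^2/2 * r1 x - g x))
    (hz : ∀ x ∈ Icc 0 Λ, zt x = - z1 x - z3 x + 3 * r1 x - 2 * s x) :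
    |((∫ x in (0:ℝ)..Λ, 2 * U x * Ut x)
      - ∫ x in (0:ℝ)..Λ, (2 * w x * wt x + ε^2/3 * (z x * wt x + w x * zt x))) / ε^2
      + (w1 0)^2 + (w2 0)^2| ≤ 14 * Q^4 * ε + 16 * Q^2 * η / ε^3 := by
  have hε := H.hε
  have hε1 := H.hε1
  have hη := H.hη
  have hQ := H.Q0
  have hQ1 := H.hQ
  have m := H.massRate hU
  rw [H.energyRate hw hz]
  set I := ∫ x in (0:ℝ)..Λ, 2 * U x * Ut x
  have g1 := csInt' H.L0 H.W.cont H.G.cont hQ (by positivity) H.bw H.bg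
  set Ig := ∫ x in (0:ℝ)..Λ, w x * g x
  have k1 := H.zk
  set Ik := ∫ x in (0:ℝ)..Λ, z x * (w x * w1 x + ε^2/2 * r1 x - g x)
  have s1 := H.ws
  set Is := ∫ x in (0:ℝ)..Λ, w x * s x
  have hw0 := H.w0
  have e1 := H.w10
  have e2 := H.w20
  have m0 : (0:ℝ) ∈ Icc 0 Λ := left_mem_Icc.2 H.L0
  have e3 := H.Z.eq 0 m0
  have e4 := H.Z1.eq 0 m0
  have hz0 := H.z0
  have hz0n := H.z0n
  have hp := H.pU
  set p := U1 0
  set a := w1 0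
  set b := w2 0
  have bw1 : |a| ≤ Q := by
    have : ε * |a| ≤ ε * Q := by
      rw [← abs_of_pos hε, ← abs_mul, abs_of_pos hε, e1]; linarith
    exact le_of_mul_le_mul_left this hε
  have bb : |ε * b| ≤ 2 * Q := by
    rw [e2]; exact (abs_sub _ _).trans (by linarith)
  have bz1 : |z1 0| ≤ 5 * Q^2 * ε := by
    have h1 : ε * z1 0 = z 0 - (w 0)^2 := by linarith
    have h2 : (w 0)^2 ≤ Q^2 * ε^2 := by
      rw [← sq_abs, ← mul_pow]; exact pow_le_pow_left₀ (abs_nonneg _) hw0 2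
    have h3 : z 0 ≤ 5 * Q^2 * ε^2 := (le_abs_self _).trans hz0
    have h4 : 0 ≤ Q^2 * ε^2 := by positivity
    have : |ε * z1 0| ≤ 5 * Q^2 * ε^2 := by
      rw [h1, abs_le]; constructor <;> nlinarith [sq_nonneg (w 0)]
    rw [abs_mul, abs_of_pos hε] at this
    exact le_of_mul_le_mul_left (by linarith) hε
  have bz2 : |z2 0| ≤ 7 * Q^2 := by
    have h1 : ε * z2 0 = z1 0 - 2 * (w 0 * a) := by linarith
    have h2 : |w 0 * a| ≤ Q * ε * Q := by
      rw [abs_mul]; exact mul_le_mul hw0 bw1 (abs_nonneg _) (by positivity)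
    have : |ε * z2 0| ≤ ε * (7 * Q^2) := by
      rw [h1]
      rw [abs_le] at *
      constructor <;> nlinarith
    rw [abs_mul, abs_of_pos hε] at this
    exact le_of_mul_le_mul_left this hε
  have q34 : Q^3 ≤ Q^4 := pow_le_pow_right₀ hQ1 (by norm_num)
  have q3n : 0 ≤ Q^3 := by positivity
  -- boundary terms
  have t1 : |(w 0)^3| ≤ ε^2 * (Q^3 * ε) := by
    rw [abs_pow]
    refine (pow_le_pow_left₀ (abs_nonneg _) hw0 3).trans (le_of_eq (by ring))
  have t2 : |z 0 * w 0| ≤ 5 * (Q^3 * ε) := by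
    rw [abs_mul]
    refine (mul_le_mul hz0 hw0 (abs_nonneg _) (by positivity)).trans ?_
    have : ε^2 * (Q^3 * ε) ≤ 1 * (Q^3 * ε) :=
      mul_le_mul_of_nonneg_right (by nlinarith) (by positivity)
    nlinarith
  have t3 : |z 0 * b| ≤ 10 * (Q^3 * ε) := by
    have : ε * |z 0 * b| ≤ ε * (10 * (Q^3 * ε)) := by
      have h : ε * |z 0 * b| = |z 0| * |ε * b| := by
        rw [abs_mul, abs_mul, abs_of_pos hε]; ring
      rw [h]
      refine (mul_le_mul hz0 bb (abs_nonneg _) (by positivity)).trans (le_of_eq (by ring))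
    exact le_of_mul_le_mul_left this hε
  have t4 : |z1 0 * a| ≤ 5 * (Q^3 * ε) := by
    rw [abs_mul]
    refine (mul_le_mul bz1 bw1 (abs_nonneg _) (by positivity)).trans (le_of_eq (by ring))
  have t5 : |z2 0 * w 0| ≤ 7 * (Q^3 * ε) := by
    rw [abs_mul]
    refine (mul_le_mul bz2 hw0 (abs_nonneg _) (by positivity)).trans (le_of_eq (by ring))
  have key : (I - ((w 0)^2 + 2 * (w 0 * b) - a^2 + 2/3 * (w 0)^3 + 2 * Ig
        + ε^2/3 * (z 0 * w 0 + z 0 * b - z1 0 * a + z2 0 * w 0)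
        - ε^2/3 * (Ik + 2 * Is))) / ε^2 + a^2 + b^2
      = ((I + p^2) - 2/3 * (w 0)^3 - 2 * Ig) / ε^2
        - 1/3 * (z 0 * w 0 + z 0 * b - z1 0 * a + z2 0 * w 0) + 1/3 * (Ik + 2 * Is) := by
    have hp' : p = a - ε * b := by linarith
    rw [← e1, hp']
    field_simp
    ring
  rw [key]
  have X : |((I + p^2) - 2/3 * (w 0)^3 - 2 * Ig) / ε^2| ≤ 2/3 * (Q^3 * ε) + 12 * Q^2 * η/ε^3 := by
    rw [abs_div, abs_of_pos (by positivity : 0 < ε^2), div_le_iff₀ (by positivity)]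
    have h1 : (2/3 * (Q^3 * ε) + 12 * Q^2 * η/ε^3) * ε^2
      = 2/3 * (ε^2 * (Q^3 * ε)) + 12 * (Q^2 * η/ε) := by field_simp
    rw [h1]
    have h2 : Q * η ≤ Q^2 * η / ε := by
      rw [le_div_iff₀ hε]
      have : Q * η * ε ≤ Q * η * Q := mul_le_mul_of_nonneg_left (by linarith) (by positivity)
      linarith
    have h3 : Q * (4 * η/ε) ≤ 4 * (Q^2 * η / ε) := by
      have : Q * (4 * η/ε) * 1 ≤ Q * (4 * η/ε) * Q :=
        mul_le_mul_of_nonneg_left (by linarith) (by positivity)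
      calc _ = Q * (4 * η/ε) * 1 := by ring
        _ ≤ _ := this
        _ = _ := by ring
    rw [abs_le] at *
    constructor <;> linarith
  have Y : Q^2 * (4 * η/ε) ≤ 4 * (Q^2 * η/ε^3) := by
    have : Q^2 * (4 * η/ε) = 4 * (Q^2 * η / ε^3) * ε^2 := by field_simp
    rw [this]
    exact mul_le_of_le_one_right (by positivity) (by nlinarith)
  have q : Q^3 * ε ≤ Q^4 * ε := mul_le_mul_of_nonneg_right q34 hε.le
  have q1 : 12 * Q^2 * η/ε^3 = 12 * (Q^2 * η/ε^3) := by ring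
  have q2 : 16 * Q^2 * η/ε^3 = 16 * (Q^2 * η/ε^3) := by ring
  rw [q1] at X
  rw [q2]
  rw [abs_le] at *
  constructor <;> linarith
end Core

namespace Core
variable {ε Λ Q η : ℝ}
  {U U1 U2 U3 w w1 w2 w3 z z1 z2 z3 r r1 g g1 s s1 f1 f2 f21 : ℝ → ℝ}

lemma _root_.intSub {Λ : ℝ} {f g : ℝ → ℝ} (hf : Continuous f) (hg : Continuous g) :
    ∫ x in (0:ℝ)..Λ, (f x - g x) = (∫ x in (0:ℝ)..Λ, f x) - ∫ x in (0:ℝ)..Λ, g x :=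
  intervalIntegral.integral_sub (hf.intervalIntegrable _ _) (hg.intervalIntegrable _ _)

lemma limE (H : Core ε Λ Q η U U1 U2 U3 w w1 w2 w3 z z1 z2 z3 r r1 g g1 s s1 f1 f2 f21)
    {ψ ψ1 : ℝ → ℝ} (dψ : ∀ x, HasDerivAt ψ (ψ1 x) x) (cψ1 : Continuous ψ1) (ψL : ψ Λ = 0)
    {κ D : ℝ} (hκ : 0 ≤ κ) (hD : 0 ≤ D) (h1 : ∫ x in (0:ℝ)..Λ, (U1 x - ψ x)^2 ≤ κ^2)
    (h2 : ∫ x in (0:ℝ)..Λ, (ψ1 x)^2 ≤ D^2) :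
    |((∫ x in (0:ℝ)..Λ, (U x)^2) - ∫ x in (0:ℝ)..Λ, ((w x)^2 + ε^2/3 * (w x * z x)))/ε^2
      - ((∫ x in (0:ℝ)..Λ, (U1 x)^2) - 1/3 * ∫ x in (0:ℝ)..Λ, (U x)^3)|
      ≤ 3 * Q^3 * ε + Q * (6 * κ + 4 * (ε * D)) := by
  have hε := H.hε
  have hε1 := H.hε1
  have hQ := H.Q0
  have hQ1 := H.hQ
  have c1 := H.W.cont
  have c2 := H.W1.cont
  have c3 := H.cU
  have c4 := H.cU1
  have c5 := H.Z.cont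
  have c6 := H.Z1.cont
  have cψ : Continuous ψ := continuous_iff_continuousAt.2 fun x => (dψ x).continuousAt
  -- difference w1 - U1
  have hdiff : ∫ x in (0:ℝ)..Λ, (w1 x - U1 x)^2 ≤ (3 * κ + 2 * (ε * D))^2 := by
    obtain ⟨h, h1', A, Aeq⟩ := Res.exists (ε := ε) (Λ := Λ) hε (f := ψ) cψ
    have cA := A.cont
    have cA1 := A.c1
    have e : h1' = fun x => (h x - ψ x) / ε := by
      funext x; have := Aeq x; field_simp; linarith
    have A1 : Res ε Λ ψ1 h1' (fun x => (h1' x - ψ1 x)/ε) := by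
      refine ⟨fun x => ?_, by fun_prop, ?_, fun x _ => by field_simp; ring⟩
      · have := ((A.hd x).sub (dψ x)).div_const ε
        rw [e] at this ⊢
        exact this
      · rw [e]; simp [A.hend, ψL]
    have B : Res ε Λ (fun x => U1 x - ψ x) (fun x => w1 x - h x) (fun x => w2 x - h1' x) := by
      have := H.W1.c1
      refine ⟨fun x => (H.W1.hd x).sub (A.hd x), by fun_prop, ?_, fun x hx => ?_⟩
      · simp [A.hend, H.W1.hend]
      · have a1 := H.W1.eq x hx
        have a2 := Aeq x
        linear_combination a1 - a2
    have b1 := (B.sq_le hε H.L0).trans h1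
    have b2 := (A1.sq_le hε H.L0).trans h2
    have : ∫ x in (0:ℝ)..Λ, (w1 x - U1 x)^2 ≤ ∫ x in (0:ℝ)..Λ, (3 * (w1 x - h x)^2 +
        (3 * (U1 x - ψ x)^2 + 3 * ε^2 * (h1' x)^2)) := by
      apply intMono H.L0 (by fun_prop) (by fun_prop)
      intro x hx
      have a2 : h x - ψ x = ε * h1' x := by linarith [Aeq x]
      have a3 : 3 * ε^2 * (h1' x)^2 = 3 * (h x - ψ x)^2 := by rw [a2]; ring
      rw [a3]
      nlinarith [sq_nonneg ((w1 x - h x) + (U1 x - ψ x)), sq_nonneg ((w1 x - h x) - (h x - ψ x)),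
        sq_nonneg ((U1 x - ψ x) + (h x - ψ x))]
    rw [intAdd (by fun_prop) (by fun_prop), intAdd (by fun_prop) (by fun_prop), intMulC, intMulC,
      intMulC] at this
    have q : 3 * ε^2 * ∫ x in (0:ℝ)..Λ, (h1' x)^2 ≤ 3 * ε^2 * D^2 :=
      mul_le_mul_of_nonneg_left b2 (by positivity)
    have : 0 ≤ κ * (ε * D) := by positivity
    nlinarith [sq_nonneg (ε * D)]
  set δ := 3 * κ + 2 * (ε * D) with hδ
  have hδ0 : 0 ≤ δ := by positivity
  have p1 : |(∫ x in (0:ℝ)..Λ, (w1 x)^2) - ∫ x in (0:ℝ)..Λ, (U1 x)^2| ≤ 2 * Q * δ := by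
    rw [← intSub (by fun_prop) (by fun_prop), intCong H.L0
      (g := fun x => (w1 x - U1 x) * w1 x + (w1 x - U1 x) * U1 x) (fun x _ => by ring),
      intAdd (by fun_prop) (by fun_prop)]
    have a := csInt' H.L0 (f := fun x => w1 x - U1 x) (g := w1) (by fun_prop) c2 hδ0 hQ hdiff H.bw1
    have b := csInt' H.L0 (f := fun x => w1 x - U1 x) (g := U1) (by fun_prop) c4 hδ0 hQ hdiff H.bU1
    exact (abs_add_le _ _).trans (by linarith)
  have p2 : |(∫ x in (0:ℝ)..Λ, w x * z x) - ∫ x in (0:ℝ)..Λ, (U x)^3| ≤ 5 * Q^3 * ε := by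
    rw [← intSub (by fun_prop) (by fun_prop), intCong H.L0
      (g := fun x => ε * (w x * z1 x) + (ε * (w1 x * ((w x)^2)) + (ε * (w1 x * (w x * U x)) +
        ε * (w1 x * (U x)^2)))) (fun x hx => by
          have a1 := H.W.eq x hx
          have a2 := H.Z.eq x hx
          have a3 : z x = ε * z1 x + (w x)^2 := by linarith
          have a4 : ε * w1 x = w x - U x := by linarith
          rw [a3]
          linear_combination (-(w x^2 + w x * U x + U x^2)) * a4),
      intAdd (by fun_prop) (by fun_prop), intAdd (by fun_prop) (by fun_prop),
      intAdd (by fun_prop) (by fun_prop), intMulC, intMulC, intMulC, intMulC, ← mul_add, ← mul_add,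
      ← mul_add, abs_mul, abs_of_pos hε]
    have a1 := csInt' H.L0 c1 c6 hQ (by positivity) H.bw H.bz1
    have a2 := csInt' H.L0 (f := w1) (g := fun x => (w x)^2) (β := Q * Q) c2 (by fun_prop) hQ
      (by positivity) H.bw1 (H.bsq (f := w) c1 (by fun_prop) H.bw fun x hx => by
        rw [sq, abs_mul]; exact mul_le_mul_of_nonneg_right (H.sw x hx) (abs_nonneg _))
    have a3 := csInt' H.L0 (f := w1) (g := fun x => w x * U x) (β := Q * Q) c2 (by fun_prop) hQ
      (by positivity) H.bw1 (H.bsq (f := U) c3 (by fun_prop) H.bU fun x hx => by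
        rw [abs_mul]; exact mul_le_mul_of_nonneg_right (H.sw x hx) (abs_nonneg _))
    have a4 := csInt' H.L0 (f := w1) (g := fun x => (U x)^2) (β := Q * Q) c2 (by fun_prop) hQ
      (by positivity) H.bw1 (H.bsq (f := U) c3 (by fun_prop) H.bU fun x hx => by
        rw [sq, abs_mul]; exact mul_le_mul_of_nonneg_right (H.sU x hx) (abs_nonneg _))
    have : |(∫ x in (0:ℝ)..Λ, w x * z1 x) + ((∫ x in (0:ℝ)..Λ, w1 x * (w x)^2) +
      ((∫ x in (0:ℝ)..Λ, w1 x * (w x * U x)) + ∫ x in (0:ℝ)..Λ, w1 x * (U x)^2))| ≤ 5 * Q^3 := by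
      refine (abs_add_le _ _).trans ?_
      refine (add_le_add_right (abs_add_le _ _) _).trans ?_
      refine (add_le_add_right (add_le_add_right (abs_add_le _ _) _) _).trans ?_
      nlinarith
    have := mul_le_mul_of_nonneg_left this hε.le
    linarith
  have p3 : (w 0)^2/ε ≤ Q^2 * ε := by
    rw [div_le_iff₀ hε, ← sq_abs]
    exact (pow_le_pow_left₀ (abs_nonneg _) H.w0 2).trans (le_of_eq (by ring))
  have p3' : 0 ≤ (w 0)^2/ε := by positivity
  have q23 : Q^2 * ε ≤ Q^3 * ε := mul_le_mul_of_nonneg_right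
    (pow_le_pow_right₀ hQ1 (by norm_num)) hε.le
  have e : ((∫ x in (0:ℝ)..Λ, (U x)^2) - ∫ x in (0:ℝ)..Λ, ((w x)^2 + ε^2/3 * (w x * z x)))/ε^2
      = (∫ x in (0:ℝ)..Λ, (w1 x)^2) + (w 0)^2/ε - 1/3 * ∫ x in (0:ℝ)..Λ, w x * z x := by
    rw [intAdd (by fun_prop) (by fun_prop), intMulC, H.W.sq hε H.L0]
    field_simp
    ring
  rw [e]
  rw [abs_le] at *
  constructor <;> nlinarith

/-- trace of the resolvent -/
lemma trace (H : Core ε Λ Q η U U1 U2 U3 w w1 w2 w3 z z1 z2 z3 r r1 g g1 s s1 f1 f2 f21)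
    {K B : ℝ} (hK : 0 ≤ K) (hB : |U1 0| ≤ B)
    (h : ∀ x ∈ Icc 0 Λ, |U x - U1 0 * x| ≤ K * x^2 + B * x^3) :
    |w2 0| ≤ 2 * K + 6 * B * ε ∧ |w1 0| ≤ |U1 0| + ε * (2 * K + 6 * B * ε) := by
  have t := H.W.taylor H.hε H.hΛ hK hB h
  have hε := H.hε
  have e1 := H.w10
  have e2 := H.w20
  have e3 : w 0 - U1 0 * ε = ε^2 * w2 0 := by rw [← e1]; linear_combination (-ε) * e2
  rw [e3, abs_mul, abs_of_pos (by positivity : 0 < ε^2)] at t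
  have b : |w2 0| ≤ 2 * K + 6 * B * ε := le_of_mul_le_mul_left (a := ε^2) (by linarith) (by positivity)
  refine ⟨b, ?_⟩
  have : w1 0 = U1 0 + ε * w2 0 := by linarith
  rw [this]
  refine (abs_add_le _ _).trans ?_
  rw [abs_mul, abs_of_pos hε]
  gcongr
end Core

lemma baireBound {T : ℝ} (A : ℕ → Set ℝ) (hc : ∀ n, IsClosed (A n)) (hm : Monotone A)
    (hcov : ∀ t ∈ Icc 0 T, ∃ n, t ∈ A n) (Ψ : ℕ → ℕ)
    (hΨ : ∀ s ∈ Icc 0 T, ∀ t ∈ Icc 0 T, (∃ B, uIcc s t ⊆ A B) → ∀ n, t ∈ A n → s ∈ A (Ψ n)) :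
    ∃ B, Icc 0 T ⊆ A B := by
  let G : ℝ → Prop := fun t => ∃ B, ∃ δ > 0, ∀ s ∈ Icc 0 T, |s - t| < δ → s ∈ A B
  have hcomp : ∀ K ⊆ Icc 0 T, IsCompact K → (∀ t ∈ K, G t) → ∃ B, K ⊆ A B := by
    intro K hK hKc hG
    have := hKc.induction_on (p := fun S => ∃ B, S ∩ Icc 0 T ⊆ A B) ⟨0, by simp⟩
      (fun S S' h ⟨B, hB⟩ => ⟨B, (inter_subset_inter_left _ h).trans hB⟩)
      (fun S S' ⟨B, hB⟩ ⟨B', hB'⟩ => ⟨max B B', by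
        rintro x ⟨h1 | h1, h2⟩
        · exact hm (le_max_left _ _) (hB ⟨h1, h2⟩)
        · exact hm (le_max_right _ _) (hB' ⟨h1, h2⟩)⟩)
      (fun t ht => by
        obtain ⟨B, δ, hδ, h⟩ := hG t ht
        refine ⟨Metric.ball t δ, mem_nhdsWithin_of_mem_nhds (Metric.ball_mem_nhds _ hδ), B, ?_⟩
        rintro x ⟨h1, h2⟩
        exact h x h2 (by simpa [Real.dist_eq] using h1))
    obtain ⟨B, hB⟩ := this
    exact ⟨B, fun x hx => hB ⟨hx, hK hx⟩⟩
  by_cases hall : ∀ t ∈ Icc 0 T, G t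
  · exact hcomp _ subset_rfl isCompact_Icc hall
  exfalso
  push Not at hall
  obtain ⟨p0, hp0, hp0G⟩ := hall
  let F : Set ℝ := Icc 0 T ∩ {t | ¬ G t}
  have hGo : IsOpen {t | G t} := by
    rw [Metric.isOpen_iff]
    rintro t ⟨B, δ, hδ, h⟩
    refine ⟨δ/2, by positivity, fun t' ht' => ⟨B, δ/2, by positivity, fun s hs hst => h s hs ?_⟩⟩
    rw [Metric.mem_ball, Real.dist_eq] at ht'
    calc |s - t| ≤ |s - t'| + |t' - t| := abs_sub_le _ _ _
      _ < δ := by linarith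
  have hF : IsClosed F := isClosed_Icc.inter hGo.isClosed_compl
  haveI : CompleteSpace F := hF.completeSpace_coe
  haveI : Nonempty F := ⟨⟨p0, hp0, hp0G⟩⟩
  obtain ⟨n, ⟨p, hp⟩, hpi⟩ := nonempty_interior_of_iUnion_of_closed
    (f := fun n => (Subtype.val ⁻¹' (A n) : Set F)) (fun n => (hc n).preimage continuous_subtype_val)
    (by
      ext x
      simp only [mem_iUnion, mem_preimage, mem_univ, iff_true]
      exact hcov x x.2.1)
  rw [mem_interior_iff_mem_nhds, Metric.mem_nhds_iff] at hpi
  obtain ⟨δ, hδ, hball⟩ := hpi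
  have hq : ∀ q ∈ F, |q - p| < δ → q ∈ A n := fun q hq hd =>
    hball (show (⟨q, hq⟩ : F) ∈ Metric.ball (⟨p, hp⟩ : F) δ by
      rw [Metric.mem_ball, Subtype.dist_eq, Real.dist_eq]; exact hd)
  apply hp.2
  refine ⟨max n (Ψ n), δ, hδ, fun t ht htp => ?_⟩
  have hseg : ∀ a ∈ Icc 0 T, ∀ b ∈ Icc 0 T, uIcc a b ⊆ Icc 0 T := fun a ha b hb =>
    ordConnected_Icc.uIcc_subset ha hb
  obtain ⟨q, ⟨hqF, hqs⟩, hqmin⟩ := (isCompact_uIcc.inter_left hF).exists_isMinOn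
    (s := F ∩ uIcc p t) ⟨p, hp, left_mem_uIcc⟩ (f := fun s => |s - t|) (by fun_prop)
  have hqn : q ∈ A n := hq q hqF (lt_of_le_of_lt (abs_sub_left_of_mem_uIcc hqs) htp)
  obtain ⟨m, hmt⟩ := hcov t ht
  have hbd : uIcc t q ⊆ A (max n (Ψ m)) := by
    intro s hs
    rw [uIcc_comm] at hs
    by_cases hsq : s = q
    · rw [hsq]; exact hm (le_max_left _ _) hqn
    refine hm (le_max_right _ _) ?_
    have hsI : s ∈ Icc 0 T := hseg q hqF.1 t ht hs
    refine hΨ s hsI t ht (hcomp _ (hseg s hsI t ht) isCompact_uIcc fun q' hq' => ?_) m hmt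
    by_contra hcon
    have hq'I := hseg s hsI t ht hq'
    have hss : uIcc s t ⊆ uIcc q t := uIcc_subset_uIcc hs right_mem_uIcc
    have hss2 : uIcc q t ⊆ uIcc p t := uIcc_subset_uIcc hqs right_mem_uIcc
    have h1 : |q - t| ≤ |q' - t| := hqmin ⟨⟨hq'I, hcon⟩, hss2 (hss hq')⟩
    have hlt : |q' - t| ≤ |s - t| := by
      rw [uIcc_comm] at hq'
      exact abs_sub_left_of_mem_uIcc hq'
    have h2 : |s - t| < |q - t| := by
      rcases le_total q t with h | h
      · rw [uIcc_of_le h] at hs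
        have : q < s := lt_of_le_of_ne hs.1 (Ne.symm hsq)
        rw [abs_of_nonpos (by linarith [hs.2]), abs_of_nonpos (by linarith)]; linarith
      · rw [uIcc_of_ge h] at hs
        have : s < q := lt_of_le_of_ne hs.2 hsq
        rw [abs_of_nonneg (by linarith [hs.1]), abs_of_nonneg (by linarith)]; linarith
    linarith
  exact hm (le_max_right _ _) (hΨ t ht q hqF.1 ⟨_, hbd⟩ n hqn)

/-- smooth functions of two variables -/
def Sm (f : ℝ → ℝ → ℝ) : Prop := ContDiff ℝ (⊤ : ℕ∞) (fun p : ℝ × ℝ => f p.1 p.2)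

def dX (f : ℝ → ℝ → ℝ) : ℝ → ℝ → ℝ := fun x t => deriv (fun y => f y t) x
def dT (f : ℝ → ℝ → ℝ) : ℝ → ℝ → ℝ := fun x t => deriv (fun s => f x s) t

namespace Sm
variable {f g : ℝ → ℝ → ℝ}

lemma diffAt (hf : Sm f) (p : ℝ × ℝ) : DifferentiableAt ℝ (fun p : ℝ × ℝ => f p.1 p.2) p :=
  (ContDiff.differentiable hf (by simp)) p

lemma cont (hf : Sm f) : Continuous (fun p : ℝ × ℝ => f p.1 p.2) := ContDiff.continuous hf

lemma hasX' (hf : Sm f) (x t : ℝ) : HasDerivAt (fun y => f y t)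
    (fderiv ℝ (fun p : ℝ × ℝ => f p.1 p.2) (x, t) (1, 0)) x := by
  have h1 : HasDerivAt (fun y : ℝ => (y, t)) ((1:ℝ), (0:ℝ)) x :=
    (hasDerivAt_id x).prodMk (hasDerivAt_const x t)
  exact (hf.diffAt (x, t)).hasFDerivAt.comp_hasDerivAt x h1

lemma hasT' (hf : Sm f) (x t : ℝ) : HasDerivAt (fun s => f x s)
    (fderiv ℝ (fun p : ℝ × ℝ => f p.1 p.2) (x, t) (0, 1)) t := by
  have h1 : HasDerivAt (fun s : ℝ => (x, s)) ((0:ℝ), (1:ℝ)) t :=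
    (hasDerivAt_const t x).prodMk (hasDerivAt_id t)
  exact (hf.diffAt (x, t)).hasFDerivAt.comp_hasDerivAt t h1

lemma hasX (hf : Sm f) (x t : ℝ) : HasDerivAt (fun y => f y t) (dX f x t) x :=
  (hf.hasX' x t).differentiableAt.hasDerivAt
lemma hasT (hf : Sm f) (x t : ℝ) : HasDerivAt (fun s => f x s) (dT f x t) t :=
  (hf.hasT' x t).differentiableAt.hasDerivAt

lemma dX_eq (hf : Sm f) : dX f = fun x t => fderiv ℝ (fun p : ℝ × ℝ => f p.1 p.2) (x, t) (1, 0) := by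
  funext x t; exact (hf.hasX' x t).deriv
lemma dT_eq (hf : Sm f) : dT f = fun x t => fderiv ℝ (fun p : ℝ × ℝ => f p.1 p.2) (x, t) (0, 1) := by
  funext x t; exact (hf.hasT' x t).deriv

lemma dx (hf : Sm f) : Sm (dX f) := by
  have h : ContDiff ℝ (⊤ : ℕ∞) (fderiv ℝ (fun p : ℝ × ℝ => f p.1 p.2)) :=
    ContDiff.fderiv_right hf (by simp)
  rw [hf.dX_eq]
  exact h.clm_apply contDiff_const
lemma dt (hf : Sm f) : Sm (dT f) := by
  have h : ContDiff ℝ (⊤ : ℕ∞) (fderiv ℝ (fun p : ℝ × ℝ => f p.1 p.2)) :=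
    ContDiff.fderiv_right hf (by simp)
  rw [hf.dT_eq]
  exact h.clm_apply contDiff_const

lemma clm_aux {Φ : ℝ × ℝ → (ℝ × ℝ →L[ℝ] ℝ)} {γ : ℝ → ℝ × ℝ} {v : ℝ × ℝ} {x : ℝ}
    (hd : DifferentiableAt ℝ Φ (γ x)) (hγ : HasDerivAt γ v x) (e : ℝ × ℝ) :
    HasDerivAt (fun y => Φ (γ y) e) (fderiv ℝ Φ (γ x) v e) x := by
  have h1 : HasDerivAt (fun y => Φ (γ y)) (fderiv ℝ Φ (γ x) v) x :=
    hd.hasFDerivAt.comp_hasDerivAt x hγ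
  have h2 := h1.clm_apply (hasDerivAt_const x e)
  rw [map_zero, add_zero] at h2
  exact h2

lemma comm (hf : Sm f) (x t : ℝ) : dX (dT f) x t = dT (dX f) x t := by
  have h : ContDiff ℝ (⊤ : ℕ∞) (fderiv ℝ (fun p : ℝ × ℝ => f p.1 p.2)) :=
    ContDiff.fderiv_right hf (by simp)
  have hd := (h.differentiable (by simp)) (x, t)
  have hs : IsSymmSndFDerivAt ℝ (fun p : ℝ × ℝ => f p.1 p.2) (x, t) :=
    (ContDiff.contDiffAt hf).isSymmSndFDerivAt (by simp; exact WithTop.coe_le_coe.2 le_top)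
  have h1 : HasDerivAt (fun y : ℝ => (y, t)) ((1:ℝ), (0:ℝ)) x :=
    (hasDerivAt_id x).prodMk (hasDerivAt_const x t)
  have h2 : HasDerivAt (fun s : ℝ => (x, s)) ((0:ℝ), (1:ℝ)) t :=
    (hasDerivAt_const t x).prodMk (hasDerivAt_id t)
  have a : dX (dT f) x t = fderiv ℝ (fderiv ℝ (fun p : ℝ × ℝ => f p.1 p.2)) (x, t) (1, 0) (0, 1) := by
    rw [hf.dT_eq]
    exact (clm_aux (γ := fun y : ℝ => (y, t)) hd h1 _).deriv
  have b : dT (dX f) x t = fderiv ℝ (fderiv ℝ (fun p : ℝ × ℝ => f p.1 p.2)) (x, t) (0, 1) (1, 0) := by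
    rw [hf.dX_eq]
    exact (clm_aux (γ := fun y : ℝ => (x, y)) hd h2 _).deriv
  rw [a, b]
  exact hs _ _

lemma add (hf : Sm f) (hg : Sm g) : Sm (fun x t => f x t + g x t) := ContDiff.add hf hg
lemma sub (hf : Sm f) (hg : Sm g) : Sm (fun x t => f x t - g x t) := ContDiff.sub hf hg
lemma mul (hf : Sm f) (hg : Sm g) : Sm (fun x t => f x t * g x t) := ContDiff.mul hf hg
lemma pow (hf : Sm f) (n : ℕ) : Sm (fun x t => (f x t)^n) := ContDiff.pow hf n
lemma ofX {φ : ℝ → ℝ} (h : ContDiff ℝ (⊤ : ℕ∞) φ) : Sm (fun x _ => φ x) := h.comp contDiff_fst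
lemma const (c : ℝ) : Sm (fun _ _ => c) := contDiff_const

lemma contX (hf : Sm f) (t : ℝ) : Continuous (fun x => f x t) :=
  hf.cont.comp (Continuous.prodMk_left t)
lemma contT (hf : Sm f) (x : ℝ) : Continuous (fun t => f x t) :=
  hf.cont.comp (Continuous.prodMk_right x)

end Sm

/-- differentiation under the integral sign -/
lemma hasDeriv_int {f ft : ℝ → ℝ → ℝ} (hc : Continuous (fun p : ℝ × ℝ => f p.1 p.2))
    (hct : Continuous (fun p : ℝ × ℝ => ft p.1 p.2))
    (hd : ∀ x t, HasDerivAt (fun s => f x s) (ft x t) t) (a b t : ℝ) :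
    HasDerivAt (fun s => ∫ x in a..b, f x s) (∫ x in a..b, ft x t) t := by
  have hcX : ∀ s, Continuous (fun x => f x s) := fun s => hc.comp (Continuous.prodMk_left s)
  have hcX' : ∀ s, Continuous (fun x => ft x s) := fun s => hct.comp (Continuous.prodMk_left s)
  obtain ⟨M, hM⟩ := ((isCompact_uIcc (a := a) (b := b)).prod
    (isCompact_Icc (a := t - 1) (b := t + 1))).exists_bound_of_continuousOn hct.continuousOn
  refine (intervalIntegral.hasDerivAt_integral_of_dominated_loc_of_deriv_le
    (F := fun s x => f x s) (F' := fun s x => ft x s) (s := Icc (t - 1) (t + 1)) (bound := fun _ => M)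
    (Icc_mem_nhds (by linarith) (by linarith))
    (Eventually.of_forall fun s => (hcX s).aestronglyMeasurable)
    ((hcX t).intervalIntegrable _ _) (hcX' t).aestronglyMeasurable
    (Eventually.of_forall fun x hx s hs => hM (x, s) ⟨uIoc_subset_uIcc hx, hs⟩)
    (by simp) (Eventually.of_forall fun x _ s _ => hd x s)).2

lemma cont_prim {k : ℝ → ℝ → ℝ} (hk : Continuous (fun p : ℝ × ℝ => k p.1 p.2)) (a : ℝ) :
    Continuous (fun p : ℝ × ℝ => ∫ y in a..p.1, k y p.2) :=
  intervalIntegral.continuous_parametric_intervalIntegral_of_continuous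
    (f := fun (p : ℝ × ℝ) y => k y p.2)
    (by
      have : Continuous (fun q : (ℝ × ℝ) × ℝ => (q.2, q.1.2)) := by fun_prop
      exact hk.comp this) continuous_fst

lemma Sm.prim {k : ℝ → ℝ → ℝ} (hk : Sm k) (a : ℝ) : Sm (fun x t => ∫ y in a..x, k y t) := by
  have key : ∀ n : ℕ, ∀ k : ℝ → ℝ → ℝ, Sm k →
      ContDiff ℝ n (fun p : ℝ × ℝ => ∫ y in a..p.1, k y p.2) := by
    intro n
    induction n with
    | zero => intro k hk; exact contDiff_zero.2 (cont_prim hk.cont a)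
    | succ n ih =>
      intro k hk
      have hF : ∀ p : ℝ × ℝ, HasFDerivAt (fun p : ℝ × ℝ => ∫ y in a..p.1, k y p.2)
          ((ContinuousLinearMap.toSpanSingleton ℝ (k p.1 p.2)).coprod
            (ContinuousLinearMap.toSpanSingleton ℝ (∫ y in a..p.1, dT k y p.2))) p := by
        intro p
        refine (hasStrictFDerivAt_uncurry_coprod (u := p) (f := fun x t => ∫ y in a..x, k y t)
          (f₁ := fun x t => ContinuousLinearMap.toSpanSingleton ℝ (k x t))
          (f₂ := fun x t => ContinuousLinearMap.toSpanSingleton ℝ (∫ y in a..x, dT k y t))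
          (Eventually.of_forall fun v => ?_) (Eventually.of_forall fun v => ?_) ?_ ?_).hasFDerivAt
        · exact (intervalIntegral.integral_hasDerivAt_right ((hk.contX v.2).intervalIntegrable _ _)
            ((hk.contX v.2).stronglyMeasurableAtFilter _ _) (hk.contX v.2).continuousAt).hasFDerivAt
        · exact (hasDeriv_int hk.cont hk.dt.cont hk.hasT a v.1 v.2).hasFDerivAt
        · apply Continuous.continuousAt
          exact (ContinuousLinearMap.toSpanSingletonCLE (𝕜 := ℝ) (E := ℝ)).continuous.comp hk.cont
        · apply Continuous.continuousAt
          exact (ContinuousLinearMap.toSpanSingletonCLE (𝕜 := ℝ) (E := ℝ)).continuous.comp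
            (cont_prim hk.dt.cont a)
      push_cast
      rw [contDiff_succ_iff_fderiv]
      refine ⟨fun p => (hF p).differentiableAt, by simp, ?_⟩
      rw [show fderiv ℝ (fun p : ℝ × ℝ => ∫ y in a..p.1, k y p.2) = fun p =>
        k p.1 p.2 • ContinuousLinearMap.fst ℝ ℝ ℝ
          + (∫ y in a..p.1, dT k y p.2) • ContinuousLinearMap.snd ℝ ℝ ℝ from by
          funext p; rw [(hF p).fderiv]; ext <;> simp]
      exact ((ContDiff.of_le hk (by exact_mod_cast le_top)).smul contDiff_const).add
        ((ih _ hk.dt).smul contDiff_const)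
  exact contDiff_infty.2 fun n => key n k hk

/-- the resolvent of a smooth function of two variables -/
lemma Sm.res {F : ℝ → ℝ → ℝ} (hF : Sm F) {ε Λ : ℝ} (hε : 0 < ε) (hz : ∀ x t, Λ ≤ x → F x t = 0) :
    ∃ h, Sm h ∧ (∀ x t, h x t - ε * dX h x t = F x t) ∧ ∀ x t, Λ ≤ x → h x t = 0 := by
  let k : ℝ → ℝ → ℝ := fun y t => Real.exp (-y/ε) * F y t
  have hk : Sm k := (Sm.ofX (φ := fun y => Real.exp (-y/ε)) (by fun_prop)).mul hF
  let h : ℝ → ℝ → ℝ := fun x t => (-(1/ε) * Real.exp (x/ε)) * ∫ y in Λ..x, k y t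
  have hh : Sm h := (Sm.ofX (φ := fun y => -(1/ε) * Real.exp (y/ε)) (by fun_prop)).mul (hk.prim Λ)
  refine ⟨h, hh, fun x t => ?_, fun x t hx => ?_⟩
  · have d1 : HasDerivAt (fun x => ∫ y in Λ..x, k y t) (k x t) x :=
      intervalIntegral.integral_hasDerivAt_right ((hk.contX t).intervalIntegrable _ _)
            ((hk.contX t).stronglyMeasurableAtFilter _ _) (hk.contX t).continuousAt
    have h2 : HasDerivAt (fun y : ℝ => y/ε) (1/ε) x := (hasDerivAt_id x).div_const ε
    have d2 := (h2.exp.const_mul (-(1/ε))).mul d1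
    have d3 : dX h x t = _ := d2.deriv
    rw [d3]
    simp only [h, k]
    have : Real.exp (x/ε) * Real.exp (-x/ε) = 1 := by rw [← Real.exp_add]; ring_nf; simp
    have e2 : ε * (1/ε) = 1 := by field_simp
    generalize Real.exp (-x/ε) = a at *
    generalize 1/ε = b at *
    generalize Real.exp (x/ε) = c at *
    linear_combination (b * c * (∫ y in Λ..x, Real.exp (-y/ε) * F y t) + c * a * F x t) * e2 + (F x t) * this
  · simp only [h]
    rw [intervalIntegral.integral_congr (g := fun _ => 0) (fun y hy => ?_)]
    · simp
    · rw [uIcc_of_le hx] at hy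
      simp only [k]
      rw [hz y t hy.1, mul_zero]

def Vn (c : ℝ) (f : ℝ → ℝ → ℝ) : Prop := ∀ x t, c ≤ x → f x t = 0

lemma Vn.dx {c : ℝ} {f : ℝ → ℝ → ℝ} (hf : Sm f) (h : Vn c f) : Vn c (dX f) := by
  intro x t hx
  have h1 : HasDerivWithinAt (fun y => f y t) (dX f x t) (Ici x) x := (hf.hasX x t).hasDerivWithinAt
  have h2 : HasDerivWithinAt (fun y => f y t) 0 (Ici x) x :=
    (hasDerivWithinAt_const x (Ici x) (0:ℝ)).congr (fun y hy => h y t (hx.trans hy)) (h x t hx)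
  exact (uniqueDiffOn_Ici x x self_mem_Ici).eq_deriv _ h1 h2

lemma Vn.dt {c : ℝ} {f : ℝ → ℝ → ℝ} (h : Vn c f) : Vn c (dT f) := by
  intro x t hx
  have : (fun s => f x s) = fun _ => 0 := funext fun s => h x s hx
  simp [dT, this]

lemma resX {ε : ℝ} {f F : ℝ → ℝ → ℝ} (hf : Sm f) (hF : Sm F)
    (h : ∀ x t, f x t - ε * dX f x t = F x t) :
    ∀ x t, dX f x t - ε * dX (dX f) x t = dX F x t := by
  intro x t
  have h1 := (hf.hasX x t).sub ((hf.dx.hasX x t).const_mul ε)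
  have h2 := hF.hasX x t
  rw [show (fun y => F y t) = fun y => f y t - ε * dX f y t from funext fun y => (h y t).symm] at h2
  exact h1.unique h2

lemma resT {ε : ℝ} {f F : ℝ → ℝ → ℝ} (hf : Sm f) (hF : Sm F)
    (h : ∀ x t, f x t - ε * dX f x t = F x t) :
    ∀ x t, dT f x t - ε * dX (dT f) x t = dT F x t := by
  intro x t
  rw [hf.comm]
  have h1 := (hf.hasT x t).sub ((hf.dx.hasT x t).const_mul ε)
  have h2 := hF.hasT x t
  rw [show (fun s => F x s) = fun s => f x s - ε * dX f x s from funext fun y => (h x y).symm] at h2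
  exact h1.unique h2

lemma mkRes {ε Λ t : ℝ} {f F : ℝ → ℝ → ℝ} (hf : Sm f) (hv : Vn Λ f)
    (h : ∀ x ∈ Icc 0 Λ, f x t - ε * dX f x t = F x t) :
    Res ε Λ (fun x => F x t) (fun x => f x t) (fun x => dX f x t) :=
  ⟨fun x => hf.hasX x t, hf.dx.contX t, hv Λ t le_rfl, h⟩

structure Bd (Λ Q η : ℝ) (U U1 f1 f2 : ℝ → ℝ) : Prop where
  hQ : 1 ≤ Q
  hη : 0 ≤ η
  bU : ∫ x in (0:ℝ)..Λ, (U x)^2 ≤ Q^2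
  bU1 : ∫ x in (0:ℝ)..Λ, (U1 x)^2 ≤ Q^2
  sU : ∀ x ∈ Icc 0 Λ, |U x| ≤ Q
  lU : ∀ x ∈ Icc 0 Λ, |U x| ≤ Q * x
  pU : |U1 0| ≤ Q
  bf1 : ∫ x in (0:ℝ)..Λ, (f1 x)^2 ≤ η^2
  bf2 : ∫ x in (0:ℝ)..Λ, (f2 x)^2 ≤ η^2

lemma dXsq {w : ℝ → ℝ → ℝ} (hw : Sm w) : dX (fun x t => (w x t)^2) = fun x t => 2 * w x t * dX w x t := by
  funext x t
  refine HasDerivAt.deriv (((hw.hasX x t).pow 2).congr_deriv ?_)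
  norm_num
lemma dTsq {w : ℝ → ℝ → ℝ} (hw : Sm w) : dT (fun x t => (w x t)^2) = fun x t => 2 * w x t * dT w x t := by
  funext x t
  refine HasDerivAt.deriv (((hw.hasT x t).pow 2).congr_deriv ?_)
  norm_num

lemma core_of {ε Λ : ℝ} (hε : 0 < ε) (hε1 : ε ≤ 1) (hΛ : 1 ≤ Λ) {U F1 F2 : ℝ → ℝ → ℝ}
    (hU : Sm U) (hF1 : Sm F1) (hF2 : Sm F2) (vU : Vn Λ U) (vF2 : Vn Λ F2)
    {I : Set ℝ} (hU0 : ∀ t ∈ I, U 0 t = 0)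
    (hpde : ∀ t ∈ I, ∀ x ∈ Icc 0 Λ, dT U x t + dX U x t + dX (dX (dX U)) x t + U x t * dX U x t
      = F1 x t + dX F2 x t) :
    ∃ w z r g s : ℝ → ℝ → ℝ, Sm w ∧ Sm z ∧
      (∀ x t, dT w x t = - dX w x t - dX (dX (dX w)) x t
        - (w x t * dX w x t + ε^2/2 * dX r x t - g x t)) ∧
      (∀ x t, dT z x t = - dX z x t - dX (dX (dX z)) x t + 3 * dX r x t - 2 * s x t) ∧
      ∀ t ∈ I, ∀ Q η, Bd Λ Q η (fun x => U x t) (fun x => dX U x t) (fun x => F1 x t)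
        (fun x => F2 x t) →
        Core ε Λ Q η (fun x => U x t) (fun x => dX U x t) (fun x => dX (dX U) x t)
        (fun x => dX (dX (dX U)) x t) (fun x => w x t) (fun x => dX w x t) (fun x => dX (dX w) x t)
        (fun x => dX (dX (dX w)) x t) (fun x => z x t) (fun x => dX z x t) (fun x => dX (dX z) x t)
        (fun x => dX (dX (dX z)) x t) (fun x => r x t) (fun x => dX r x t)
        (fun x => g x t) (fun x => dX g x t) (fun x => s x t) (fun x => dX s x t)
        (fun x => F1 x t) (fun x => F2 x t) (fun x => dX F2 x t) := by
  obtain ⟨w, hw, ew, vw⟩ := hU.res (Λ := Λ) hε vU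
  obtain ⟨z, hz, ez, vz⟩ := (hw.pow 2).res (Λ := Λ) hε (fun x t hx => by rw [vw x t hx]; simp)
  have vw1 : Vn Λ (dX w) := Vn.dx hw vw
  obtain ⟨r, hr, er, vr⟩ := (hw.dx.pow 2).res (Λ := Λ) hε (fun x t hx => by rw [vw1 x t hx]; simp)
  have vr : Vn Λ r := vr
  have vw : Vn Λ w := vw
  have vz : Vn Λ z := vz
  have vw2 := Vn.dx hw.dx vw1
  have vw3 := Vn.dx hw.dx.dx vw2
  have vwt := vw.dt
  have vz1 := Vn.dx hz vz
  have vz2 := Vn.dx hz.dx vz1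
  have vz3 := Vn.dx hz.dx.dx vz2
  have vzt := vz.dt
  have vr1 := Vn.dx hr vr
  let g : ℝ → ℝ → ℝ := fun x t => dT w x t + dX w x t + dX (dX (dX w)) x t + w x t * dX w x t
    + ε^2/2 * dX r x t
  have hg : Sm g := ((((hw.dt.add hw.dx).add hw.dx.dx.dx).add (hw.mul hw.dx)).add
    ((Sm.const _).mul hr.dx))
  have vg : Vn Λ g := fun x t hx => by
    simp only [g]; rw [vwt x t hx, vw1 x t hx, vw3 x t hx, vr1 x t hx]; ring
  let s : ℝ → ℝ → ℝ := fun x t => (-1/2) * (dT z x t + dX z x t + dX (dX (dX z)) x t - 3 * dX r x t)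
  have hs : Sm s := (Sm.const _).mul (((hz.dt.add hz.dx).add hz.dx.dx.dx).sub
    ((Sm.const _).mul hr.dx))
  have vs : Vn Λ s := fun x t hx => by
    simp only [s]; rw [vzt x t hx, vz1 x t hx, vz3 x t hx, vr1 x t hx]; ring
  have dg : ∀ x t, dX g x t = dX (dT w) x t + dX (dX w) x t + dX (dX (dX (dX w))) x t
      + (dX w x t * dX w x t + w x t * dX (dX w) x t) + ε^2/2 * dX (dX r) x t := fun x t =>
    HasDerivAt.deriv (((((hw.dt.hasX x t).add (hw.dx.hasX x t)).add (hw.dx.dx.dx.hasX x t)).add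
      ((hw.hasX x t).mul (hw.dx.hasX x t))).add ((hr.dx.hasX x t).const_mul (ε^2/2)))
  have ds : ∀ x t, dX s x t = (-1/2) * (dX (dT z) x t + dX (dX z) x t + dX (dX (dX (dX z))) x t
      - 3 * dX (dX r) x t) := fun x t =>
    HasDerivAt.deriv ((((((hz.dt.hasX x t).add (hz.dx.hasX x t)).add (hz.dx.dx.dx.hasX x t)).sub
      ((hr.dx.hasX x t).const_mul 3))).const_mul (-1/2))
  -- resolvent identities
  have ew1 := resX hw hU ew
  have ew2 := resX hw.dx hU.dx ew1
  have ew3 := resX hw.dx.dx hU.dx.dx ew2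
  have ewt := resT hw hU ew
  have hw2 : Sm (fun x t => 2 * w x t * dX w x t) := ((Sm.const 2).mul hw).mul hw.dx
  have ez1 : ∀ x t, dX z x t - ε * dX (dX z) x t = 2 * w x t * dX w x t := by
    have := resX hz (hw.pow 2) ez
    rwa [dXsq hw] at this
  have hw22 : Sm (fun x t => 2 * (dX w x t)^2 + 2 * w x t * dX (dX w) x t) :=
    ((Sm.const 2).mul (hw.dx.pow 2)).add (((Sm.const 2).mul hw).mul hw.dx.dx)
  have ez2 : ∀ x t, dX (dX z) x t - ε * dX (dX (dX z)) x t
      = 2 * (dX w x t)^2 + 2 * w x t * dX (dX w) x t := by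
    intro x t
    rw [resX hz.dx hw2 ez1]
    refine HasDerivAt.deriv ((((hw.hasX x t).const_mul 2).mul (hw.dx.hasX x t)).congr_deriv ?_)
    ring
  have ez3 : ∀ x t, dX (dX (dX z)) x t - ε * dX (dX (dX (dX z))) x t
      = 6 * dX w x t * dX (dX w) x t + 2 * w x t * dX (dX (dX w)) x t := by
    intro x t
    rw [resX hz.dx.dx hw22 ez2]
    refine HasDerivAt.deriv (((((hw.dx.hasX x t).pow 2).const_mul 2).add
      (((hw.hasX x t).const_mul 2).mul (hw.dx.dx.hasX x t))).congr_deriv ?_)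
    norm_num
    ring
  have ezt : ∀ x t, dT z x t - ε * dX (dT z) x t = 2 * w x t * dT w x t := by
    have := resT hz (hw.pow 2) ez
    rwa [dTsq hw] at this
  have er1 : ∀ x t, dX r x t - ε * dX (dX r) x t = 2 * dX w x t * dX (dX w) x t := by
    have := resX hr (hw.dx.pow 2) er
    rwa [dXsq hw.dx] at this
  have hwt : ∀ x t, dT w x t = - dX w x t - dX (dX (dX w)) x t
        - (w x t * dX w x t + ε^2/2 * dX r x t - g x t) := fun x t => by simp only [g]; ring
  refine ⟨w, z, r, g, s, hw, hz, hwt, ?_, ?_⟩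
  · intro x t; simp only [s]; ring
  · intro t ht Q η B
    refine ⟨hε, hε1, hΛ, B.hQ, B.hη, fun x => hU.hasX x t, fun x => hU.dx.hasX x t,
      fun x => hU.dx.dx.hasX x t, hU.dx.dx.dx.contX t, hU0 t ht, vU Λ t le_rfl,
      Vn.dx hU vU Λ t le_rfl, Vn.dx hU.dx (Vn.dx hU vU) Λ t le_rfl,
      mkRes hw vw fun x _ => ew x t, mkRes hw.dx vw1 fun x _ => ew1 x t,
      mkRes hw.dx.dx vw2 fun x _ => ew2 x t,
      mkRes (F := fun x t => (w x t)^2) hz vz fun x _ => ez x t,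
      mkRes (F := fun x t => 2 * w x t * dX w x t) hz.dx vz1 fun x _ => ez1 x t,
      mkRes (F := fun x t => 2 * (dX w x t)^2 + 2 * w x t * dX (dX w) x t) hz.dx.dx vz2
        fun x _ => ez2 x t,
      mkRes (F := fun x t => (dX w x t)^2) hr vr fun x _ => er x t,
      fun x => hF2.hasX x t, hF2.dx.contX t, hF1.contX t, vF2 Λ t le_rfl,
      mkRes (F := fun x t => F1 x t + dX F2 x t) hg vg fun x hx => ?_,
      mkRes (F := fun x t => w x t * (w x t * dX w x t + ε^2/2 * dX r x t - g x t)) hs vs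
        fun x hx => ?_,
      B.bU, B.bU1, B.sU, B.lU, B.pU, B.bf1, B.bf2⟩
    · rw [← hpde t ht x hx, dg]
      have a1 := ewt x t
      have a2 := ew1 x t
      have a3 := ew3 x t
      have a4 := er1 x t
      have a5 := ew x t
      simp only [g]
      linear_combination a1 + a2 + a3 + ε^2/2 * a4 + (dX w x t - ε * dX (dX w) x t) * a5 + U x t * a2
    · rw [ds]
      have a1 := ezt x t
      have a2 := ez1 x t
      have a3 := ez3 x t
      have a4 := er1 x t
      have a5 := hwt x t
      simp only [s]
      linear_combination (-1/2) * a1 + (-1/2) * a2 + (-1/2) * a3 + 3/2 * a4 - w x t * a5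

/-- the evolution of the modified energies -/
lemma evolution {ε Λ : ℝ} (hε : 0 < ε) (hε1 : ε ≤ 1) (hΛ : 1 ≤ Λ) {U F1 F2 : ℝ → ℝ → ℝ}
    (hU : Sm U) (hF1 : Sm F1) (hF2 : Sm F2) (vU : Vn Λ U) (vF2 : Vn Λ F2)
    {I : Set ℝ} (hU0 : ∀ t ∈ I, U 0 t = 0)
    (hpde : ∀ t ∈ I, ∀ x ∈ Icc 0 Λ, dT U x t + dX U x t + dX (dX (dX U)) x t + U x t * dX U x t
      = F1 x t + dX F2 x t) :
    ∃ E m' e' : ℝ → ℝ, Continuous m' ∧ Continuous e' ∧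
      (∀ t, HasDerivAt (fun t => ∫ x in (0:ℝ)..Λ, (U x t)^2) (m' t) t) ∧
      (∀ t, HasDerivAt E (e' t) t) ∧
      ∀ t ∈ I, ∀ Q η, Bd Λ Q η (fun x => U x t) (fun x => dX U x t) (fun x => F1 x t)
        (fun x => F2 x t) →
        |m' t + (dX U 0 t)^2| ≤ 4 * Q * η ∧
        e' t ≤ 14 * Q^4 * ε + 16 * Q^2 * η / ε^3 ∧
        (∀ K B P, 0 ≤ K → |dX U 0 t| ≤ B → |dX U 0 t| ≤ P →
          (∀ x ∈ Icc 0 Λ, |U x t - dX U 0 t * x| ≤ K * x^2 + B * x^3) →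
          -((P + ε * (2 * K + 6 * B * ε))^2 + (2 * K + 6 * B * ε)^2)
            - (14 * Q^4 * ε + 16 * Q^2 * η / ε^3) ≤ e' t) ∧
        (∀ (ψ ψ1 : ℝ → ℝ) (κ D : ℝ), (∀ x, HasDerivAt ψ (ψ1 x) x) → Continuous ψ1 → ψ Λ = 0 →
          0 ≤ κ → 0 ≤ D → ∫ x in (0:ℝ)..Λ, (dX U x t - ψ x)^2 ≤ κ^2 →
          ∫ x in (0:ℝ)..Λ, (ψ1 x)^2 ≤ D^2 →
          |E t - ((∫ x in (0:ℝ)..Λ, (dX U x t)^2) - 1/3 * ∫ x in (0:ℝ)..Λ, (U x t)^3)|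
            ≤ 3 * Q^3 * ε + Q * (6 * κ + 4 * (ε * D))) := by
  obtain ⟨w, z, r, g, s, hw, hz, ewt, ezt, hcore⟩ := core_of hε hε1 hΛ hU hF1 hF2 vU vF2 hU0 hpde
  let m' : ℝ → ℝ := fun t => ∫ x in (0:ℝ)..Λ, 2 * U x t * dT U x t
  let j' : ℝ → ℝ := fun t => ∫ x in (0:ℝ)..Λ, (2 * w x t * dT w x t
    + ε^2/3 * (z x t * dT w x t + w x t * dT z x t))
  let E : ℝ → ℝ := fun t => ((∫ x in (0:ℝ)..Λ, (U x t)^2)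
    - ∫ x in (0:ℝ)..Λ, ((w x t)^2 + ε^2/3 * (w x t * z x t)))/ε^2
  have sm : Sm (fun x t => 2 * U x t * dT U x t) := ((Sm.const 2).mul hU).mul hU.dt
  have sj : Sm (fun x t => 2 * w x t * dT w x t + ε^2/3 * (z x t * dT w x t + w x t * dT z x t)) :=
    (((Sm.const 2).mul hw).mul hw.dt).add ((Sm.const _).mul ((hz.mul hw.dt).add (hw.mul hz.dt)))
  have sj0 : Sm (fun x t => (w x t)^2 + ε^2/3 * (w x t * z x t)) :=
    (hw.pow 2).add ((Sm.const _).mul (hw.mul hz))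
  have cp : ∀ {f : ℝ → ℝ → ℝ}, Sm f → Continuous fun t => ∫ x in (0:ℝ)..Λ, f x t := fun {f} hf =>
    intervalIntegral.continuous_parametric_intervalIntegral_of_continuous' (f := fun t x => f x t)
      (hf.cont.comp continuous_swap) _ _
  have dm : ∀ t, HasDerivAt (fun t => ∫ x in (0:ℝ)..Λ, (U x t)^2) (m' t) t := fun t =>
    hasDeriv_int (f := fun x t => (U x t)^2) (ft := fun x t => 2 * U x t * dT U x t) (hU.pow 2).cont sm.cont (fun x t =>
      ((hU.hasT x t).pow 2).congr_deriv (by norm_num)) 0 Λ t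
  have dj : ∀ t, HasDerivAt (fun t => ∫ x in (0:ℝ)..Λ, ((w x t)^2 + ε^2/3 * (w x t * z x t))) (j' t) t :=
    fun t => hasDeriv_int (f := fun x t => (w x t)^2 + ε^2/3 * (w x t * z x t)) (ft := fun x t => 2 * w x t * dT w x t + ε^2/3 * (z x t * dT w x t + w x t * dT z x t)) sj0.cont sj.cont (fun x t =>
      (((hw.hasT x t).pow 2).add (((hw.hasT x t).mul (hz.hasT x t)).const_mul (ε^2/3))).congr_deriv
        (by push_cast; ring)) 0 Λ t
  refine ⟨E, m', fun t => (m' t - j' t)/ε^2, cp sm, ((cp sm).sub (cp sj)).div_const _, dm,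
    fun t => ((dm t).sub (dj t)).div_const _, ?_⟩
  intro t ht Q η B
  have C := hcore t ht Q η B
  have hUt : ∀ x ∈ Icc 0 Λ, dT U x t = - dX U x t - dX (dX (dX U)) x t - U x t * dX U x t
    + F1 x t + dX F2 x t := fun x hx => by linear_combination hpde t ht x hx
  have h1 := C.massRate (Ut := fun x => dT U x t) hUt
  have h2 := C.finalRate (Ut := fun x => dT U x t) (wt := fun x => dT w x t)
    (zt := fun x => dT z x t) hUt (fun x _ => ewt x t) (fun x _ => ezt x t)
  refine ⟨h1, ?_, ?_, ?_⟩
  · have := (abs_le.1 h2).2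
    have a1 := sq_nonneg (dX w 0 t)
    have a2 := sq_nonneg (dX (dX w) 0 t)
    show (m' t - j' t)/ε^2 ≤ _
    simp only [m', j']
    linarith
  · intro K Bc P hK hB hP htay
    obtain ⟨b1, b2⟩ := C.trace hK hB htay
    have := (abs_le.1 h2).1
    have a1 : (dX w 0 t)^2 ≤ (P + ε * (2 * K + 6 * Bc * ε))^2 := by
      rw [← sq_abs]; exact pow_le_pow_left₀ (abs_nonneg _) (b2.trans (by linarith)) 2
    have a2 : (dX (dX w) 0 t)^2 ≤ (2 * K + 6 * Bc * ε)^2 := by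
      rw [← sq_abs]; exact pow_le_pow_left₀ (abs_nonneg _) b1 2
    show _ ≤ (m' t - j' t)/ε^2
    simp only [m', j']
    linarith
  · intro ψ ψ1 κ D d c l hκ hD i1 i2
    exact C.limE d c l hκ hD i1 i2

structure Cut (c : ℝ) (a : ℕ → ℝ → ℝ) : Prop where
  hc : 1 ≤ c
  sm : ∀ n, ContDiff ℝ (⊤ : ℕ∞) (a n)
  n0 : ∀ n x, 0 ≤ a n x
  n1 : ∀ n x, a n x ≤ 1
  one : ∀ (n : ℕ) x, x ≤ (n:ℝ) + 1 → a n x = 1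
  zero : ∀ (n : ℕ) x, 2 * ((n:ℝ) + 1) ≤ x → a n x = 0
  b1 : ∀ (n : ℕ) x, |deriv (a n) x| ≤ c * ((n:ℝ) + 1)⁻¹
  b3 : ∀ (n : ℕ) x, |deriv (deriv (deriv (a n))) x| ≤ c * ((n:ℝ) + 1)⁻¹

lemma derivZero {f : ℝ → ℝ} {s : Set ℝ} (hs : IsOpen s) {k : ℝ} (h : ∀ x ∈ s, f x = k) :
    ∀ x ∈ s, deriv f x = 0 := by
  intro x hx
  have : f =ᶠ[nhds x] fun _ => k := by
    filter_upwards [hs.mem_nhds hx] with y hy using h y hy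
  rw [this.deriv_eq]; simp

lemma bddOf {f : ℝ → ℝ} (hf : Continuous f) (h : ∀ x ∈ Iio (1:ℝ) ∪ Ioi 2, f x = 0) :
    ∃ c, 1 ≤ c ∧ ∀ x, |f x| ≤ c := by
  obtain ⟨M, hM⟩ := (isCompact_Icc (a := (1:ℝ)) (b := 2)).exists_bound_of_continuousOn hf.continuousOn
  refine ⟨max M 1, le_max_right _ _, fun x => ?_⟩
  by_cases hx : x ∈ Icc (1:ℝ) 2
  · exact (hM x hx).trans (le_max_left _ _)
  · rw [h x]
    · simp
    · simp only [mem_Icc, not_and_or, not_le] at hx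
      rcases hx with hx | hx
      · left; exact hx
      · right; exact hx

lemma cutEx : ∃ c a, Cut c a := by
  let χ : ℝ → ℝ := fun y => Real.smoothTransition (2 - y)
  have hχ : ContDiff ℝ (⊤ : ℕ∞) χ := Real.smoothTransition.contDiff.comp (contDiff_const.sub contDiff_id)
  have h1 : ContDiff ℝ (⊤ : ℕ∞) (deriv χ) := (contDiff_infty_iff_deriv.1 hχ).2
  have h2 : ContDiff ℝ (⊤ : ℕ∞) (deriv (deriv χ)) := (contDiff_infty_iff_deriv.1 h1).2
  have h3 : ContDiff ℝ (⊤ : ℕ∞) (deriv (deriv (deriv χ))) := (contDiff_infty_iff_deriv.1 h2).2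
  have o : IsOpen (Iio (1:ℝ) ∪ Ioi 2) := isOpen_Iio.union isOpen_Ioi
  have c1 : ∀ x ≤ (1:ℝ), χ x = 1 := fun x hx => Real.smoothTransition.one_of_one_le (by linarith)
  have c0 : ∀ x, (2:ℝ) ≤ x → χ x = 0 := fun x hx => Real.smoothTransition.zero_of_nonpos (by linarith)
  have z1 : ∀ x ∈ Iio (1:ℝ) ∪ Ioi 2, deriv χ x = 0 := by
    rintro x (hx | hx)
    · exact derivZero isOpen_Iio (fun y hy => c1 y (le_of_lt hy)) x hx
    · exact derivZero isOpen_Ioi (fun y hy => c0 y (le_of_lt hy)) x hx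
  have z2 := derivZero o z1
  have z3 := derivZero o z2
  obtain ⟨k1, hk1, b1⟩ := bddOf h1.continuous z1
  obtain ⟨k3, hk3, b3⟩ := bddOf h3.continuous z3
  have l0 : ∀ n : ℕ, 0 < ((n:ℝ)+1)⁻¹ := fun n => by positivity
  have l1 : ∀ n : ℕ, ((n:ℝ)+1)⁻¹ ≤ 1 := fun n => inv_le_one_of_one_le₀ (by linarith [n.cast_nonneg (α := ℝ)])
  have d1 : ∀ l : ℝ, deriv (fun x => χ (l * x)) = fun x => l * deriv χ (l * x) := fun l => by
    funext x; rw [deriv_comp_mul_left]; rfl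
  have d2 : ∀ l : ℝ, deriv (fun x => l * deriv χ (l * x)) = fun x => l * (l * deriv (deriv χ) (l * x)) := fun l => by
    funext x; rw [deriv_const_mul_field, deriv_comp_mul_left]; rfl
  have d3 : ∀ l : ℝ, deriv (fun x => l * (l * deriv (deriv χ) (l * x)))
      = fun x => l * (l * (l * deriv (deriv (deriv χ)) (l * x))) := fun l => by
    funext x; rw [deriv_const_mul_field, deriv_const_mul_field, deriv_comp_mul_left]; rfl
  refine ⟨max k1 k3, fun n x => χ (((n:ℝ)+1)⁻¹ * x), hk1.trans (le_max_left _ _),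
    fun n => hχ.comp (contDiff_const.mul contDiff_id),
    fun n x => Real.smoothTransition.nonneg _, fun n x => Real.smoothTransition.le_one _,
    fun n x hx => c1 _ ?_, fun n x hx => c0 _ ?_, fun n x => ?_, fun n x => ?_⟩
  · rw [inv_mul_le_iff₀ (by positivity)]; linarith
  · rw [le_inv_mul_iff₀ (by positivity)]; linarith
  · rw [d1, abs_mul, abs_of_pos (l0 n), mul_comm]
    exact mul_le_mul_of_nonneg_right ((b1 _).trans (le_max_left _ _)) (l0 n).le
  · rw [d1, d2, d3]
    simp only [abs_mul, abs_of_pos (l0 n)]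
    have hb := (b3 (((n:ℝ)+1)⁻¹ * x)).trans (le_max_right k1 k3)
    have := l0 n
    have := l1 n
    calc _ ≤ ((n:ℝ)+1)⁻¹ * (1 * (1 * max k1 k3)) := by gcongr
      _ = _ := by ring

lemma Cut.b1' {c a} (h : Cut c a) (n : ℕ) (x : ℝ) : |deriv (a n) x| ≤ c :=
  (h.b1 n x).trans (mul_le_of_le_one_right (by linarith [h.hc]) (inv_le_one_of_one_le₀ (by linarith [n.cast_nonneg (α := ℝ)])))
lemma Cut.b3' {c a} (h : Cut c a) (n : ℕ) (x : ℝ) : |deriv (deriv (deriv (a n))) x| ≤ c :=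
  (h.b3 n x).trans (mul_le_of_le_one_right (by linarith [h.hc]) (inv_le_one_of_one_le₀ (by linarith [n.cast_nonneg (α := ℝ)])))
lemma invLim : Tendsto (fun n : ℕ => ((n:ℝ)+1)⁻¹) atTop (nhds 0) := by
  simpa using tendsto_one_div_add_atTop_nhds_zero_nat (𝕜 := ℝ)
lemma Cut.t1 {c a} (h : Cut c a) (x : ℝ) : Tendsto (fun n => deriv (a n) x) atTop (nhds 0) :=
  squeeze_zero_norm (fun n => h.b1 n x) (by simpa using invLim.const_mul c)
lemma Cut.t3 {c a} (h : Cut c a) (x : ℝ) : Tendsto (fun n => deriv (deriv (deriv (a n))) x) atTop (nhds 0) :=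
  squeeze_zero_norm (fun n => h.b3 n x) (by simpa using invLim.const_mul c)
lemma Cut.t0 {c a} (h : Cut c a) (x : ℝ) : Tendsto (fun n => a n x) atTop (nhds 1) := by
  refine tendsto_const_nhds.congr' ?_
  filter_upwards [eventually_ge_atTop ⌈x⌉₊] with n hn
  rw [h.one n x]
  have := Nat.le_of_ceil_le hn
  linarith

def cU (a : ℝ → ℝ) (u : ℝ → ℝ → ℝ) : ℝ → ℝ → ℝ := fun x t => a x * u x t
def cF2 (a : ℝ → ℝ) (u : ℝ → ℝ → ℝ) : ℝ → ℝ → ℝ := fun x t => 3 * (deriv a x * dX u x t)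
def cF1 (a : ℝ → ℝ) (u : ℝ → ℝ → ℝ) : ℝ → ℝ → ℝ := fun x t =>
  deriv a x * u x t + deriv (deriv (deriv a)) x * u x t + ((a x)^2 - a x) * (u x t * dX u x t)
    + a x * deriv a x * (u x t)^2

section
variable {a : ℝ → ℝ} {u : ℝ → ℝ → ℝ}

lemma smD (ha : ContDiff ℝ (⊤ : ℕ∞) a) : ContDiff ℝ (⊤ : ℕ∞) (deriv a) := (contDiff_infty_iff_deriv.1 ha).2
lemma hasA (ha : ContDiff ℝ (⊤ : ℕ∞) a) (x : ℝ) : HasDerivAt a (deriv a x) x := ((contDiff_infty_iff_deriv.1 ha).1 x).hasDerivAt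
lemma cU_sm (ha : ContDiff ℝ (⊤ : ℕ∞) a) (hu : Sm u) : Sm (cU a u) := (Sm.ofX ha).mul hu
lemma cF2_sm (ha : ContDiff ℝ (⊤ : ℕ∞) a) (hu : Sm u) : Sm (cF2 a u) := (Sm.const 3).mul ((Sm.ofX (smD ha)).mul hu.dx)
lemma cF1_sm (ha : ContDiff ℝ (⊤ : ℕ∞) a) (hu : Sm u) : Sm (cF1 a u) :=
  ((((Sm.ofX (smD ha)).mul hu).add ((Sm.ofX (smD (smD (smD ha)))).mul hu)).add
    ((((Sm.ofX ha).pow 2).sub (Sm.ofX ha)).mul (hu.mul hu.dx))).add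
    (((Sm.ofX ha).mul (Sm.ofX (smD ha))).mul (hu.pow 2))

lemma cU_x (ha : ContDiff ℝ (⊤ : ℕ∞) a) (hu : Sm u) : dX (cU a u) = fun x t => deriv a x * u x t + a x * dX u x t := by
  funext x t
  exact ((hasA ha x).mul (hu.hasX x t)).deriv
lemma cU_t (ha : ContDiff ℝ (⊤ : ℕ∞) a) (hu : Sm u) : dT (cU a u) = fun x t => a x * dT u x t := by
  funext x t
  exact ((hu.hasT x t).const_mul (a x)).deriv
lemma cU_xx (ha : ContDiff ℝ (⊤ : ℕ∞) a) (hu : Sm u) : dX (dX (cU a u)) = fun x t => deriv (deriv a) x * u x t + 2 * deriv a x * dX u x t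
    + a x * dX (dX u) x t := by
  rw [cU_x ha hu]
  funext x t
  refine HasDerivAt.deriv ((((hasA (smD ha) x).mul (hu.hasX x t)).add
    ((hasA ha x).mul (hu.dx.hasX x t))).congr_deriv ?_)
  ring
lemma cU_xxx (ha : ContDiff ℝ (⊤ : ℕ∞) a) (hu : Sm u) : dX (dX (dX (cU a u))) = fun x t => deriv (deriv (deriv a)) x * u x t
    + 3 * deriv (deriv a) x * dX u x t + 3 * deriv a x * dX (dX u) x t
    + a x * dX (dX (dX u)) x t := by
  rw [cU_xx ha hu]
  funext x t
  refine HasDerivAt.deriv ((((hasA (smD (smD ha)) x).mul (hu.hasX x t)).add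
    ((((hasA (smD ha) x).const_mul 2).mul (hu.dx.hasX x t)))).add
    ((hasA ha x).mul (hu.dx.dx.hasX x t)) |>.congr_deriv ?_)
  ring
lemma cF2_x (ha : ContDiff ℝ (⊤ : ℕ∞) a) (hu : Sm u) : dX (cF2 a u) = fun x t => 3 * (deriv (deriv a) x * dX u x t + deriv a x * dX (dX u) x t) := by
  funext x t
  exact (((hasA (smD ha) x).mul (hu.dx.hasX x t)).const_mul 3).deriv

lemma cut_pde (ha : ContDiff ℝ (⊤ : ℕ∞) a) (hu : Sm u) {x t : ℝ} (h : dT u x t + dX u x t + dX (dX (dX u)) x t + u x t * dX u x t = 0) :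
    dT (cU a u) x t + dX (cU a u) x t + dX (dX (dX (cU a u))) x t + cU a u x t * dX (cU a u) x t
      = cF1 a u x t + dX (cF2 a u) x t := by
  rw [cU_xxx ha hu, cU_x ha hu, cU_t ha hu, cF2_x ha hu]
  simp only [cU, cF1]
  linear_combination a x * h
end

lemma cU_v {c : ℝ} {a : ℝ → ℝ} {u : ℝ → ℝ → ℝ} (h : ∀ x, c ≤ x → a x = 0) : Vn c (cU a u) :=
  fun x t hx => by simp [cU, h x hx]
lemma cF2_v {c : ℝ} {a : ℝ → ℝ} {u : ℝ → ℝ → ℝ} (ha : ContDiff ℝ (⊤ : ℕ∞) a)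
    (h : ∀ x, c ≤ x → a x = 0) : Vn c (cF2 a u) := by
  have : Vn c (dX (fun x _ => a x)) := Vn.dx (Sm.ofX ha) (fun x t hx => h x hx)
  intro x t hx
  have h2 := this x t hx
  simp only [dX] at h2
  simp [cF2, h2]

/-- dominated convergence on growing intervals -/
lemma dctLim {F : ℕ → ℝ → ℝ} {f g : ℝ → ℝ} (hg : IntegrableOn g (Ioi 0))
    (hF : ∀ n, Continuous (F n)) (hb : ∀ n, ∀ x, 0 < x → |F n x| ≤ g x)
    (hl : ∀ x, 0 < x → Tendsto (fun n => F n x) atTop (nhds (f x))) :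
    Tendsto (fun n : ℕ => ∫ x in (0:ℝ)..(2 * ((n:ℝ)+1)), F n x) atTop (nhds (∫ x in Ioi (0:ℝ), f x)) := by
  have e : ∀ n : ℕ, ∫ x in (0:ℝ)..(2 * ((n:ℝ)+1)), F n x
      = ∫ x in Ioi (0:ℝ), (Iic (2 * ((n:ℝ)+1))).indicator (F n) x := by
    intro n
    rw [intervalIntegral.integral_of_le (by positivity), setIntegral_indicator measurableSet_Iic,
      Ioi_inter_Iic]
  simp_rw [e]
  refine tendsto_integral_of_dominated_convergence g
    (fun n => ((hF n).aestronglyMeasurable.indicator measurableSet_Iic)) hg (fun n => ?_) ?_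
  · filter_upwards [ae_restrict_mem measurableSet_Ioi] with x hx
    refine (norm_indicator_le_norm_self _ _).trans (hb n x hx)
  · filter_upwards [ae_restrict_mem measurableSet_Ioi] with x hx
    refine (hl x hx).congr' ?_
    filter_upwards [eventually_ge_atTop ⌈x⌉₊] with n hn
    have := Nat.le_of_ceil_le hn
    rw [indicator_of_mem]
    simp only [mem_Iic]
    linarith [n.cast_nonneg (α := ℝ)]

structure St (S P K : ℝ) (u : ℝ → ℝ → ℝ) (t : ℝ) : Prop where
  hS : 1 ≤ S
  hP : 0 ≤ P
  hK : 0 ≤ K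
  sm : Sm u
  bc : u 0 t = 0
  bd : ∀ R, 0 ≤ R → ∫ x in (0:ℝ)..R, ((u x t)^2 + (dX u x t)^2) ≤ S^2
  hp : |dX u 0 t| ≤ P
  tay : ∀ x ∈ Icc (0:ℝ) 1, |u x t - dX u 0 t * x| ≤ K * x^2

lemma sqLe {u : ℝ → ℝ → ℝ} {t : ℝ} (hu : Sm u) (h0 : u 0 t = 0) {x : ℝ} (hx : 0 ≤ x) :
    (u x t)^2 ≤ ∫ y in (0:ℝ)..x, ((u y t)^2 + (dX u y t)^2) := by
  have c0 := hu.contX t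
  have c1 := hu.dx.contX t
  have h := ftc (Λ := x) (F := fun y => (u y t)^2) (F' := fun y => 2 * u y t * dX u y t)
    (fun y => ((hu.hasX y t).pow 2).congr_deriv (by norm_num)) (by fun_prop)
  simp only [h0] at h
  have h2 : ∫ y in (0:ℝ)..x, 2 * u y t * dX u y t ≤ ∫ y in (0:ℝ)..x, ((u y t)^2 + (dX u y t)^2) :=
    intMono hx (by fun_prop) (by fun_prop) fun y _ => by nlinarith [sq_nonneg (u y t - dX u y t)]
  linarith

namespace St
variable {S P K : ℝ} {u : ℝ → ℝ → ℝ} {t : ℝ}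

lemma sup (h : St S P K u t) {x : ℝ} (hx : 0 ≤ x) : |u x t| ≤ S :=
  abs_le_of_sq_le_sq ((sqLe h.sm h.bc hx).trans (h.bd x hx)) (by linarith [h.hS])

lemma int (h : St S P K u t) : IntegrableOn (fun x => (u x t)^2 + (dX u x t)^2) (Ioi 0) := by
  have c0 := h.sm.contX t
  have c1 := h.sm.dx.contX t
  have c : Continuous (fun x => (u x t)^2 + (dX u x t)^2) := by fun_prop
  refine integrableOn_Ioi_of_intervalIntegral_norm_bounded (S^2) 0 (l := atTop) (b := fun n : ℕ => (n:ℝ))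
    (fun n => c.integrableOn_Ioc) tendsto_natCast_atTop_atTop (Eventually.of_forall fun n => ?_)
  refine le_trans (le_of_eq ?_) (h.bd n n.cast_nonneg)
  refine intervalIntegral.integral_congr fun x _ => ?_
  exact Real.norm_of_nonneg (by positivity)

lemma int0 (h : St S P K u t) : IntegrableOn (fun x => (u x t)^2) (Ioi 0) := by
  have c0 := h.sm.contX t
  refine Integrable.mono' h.int (by fun_prop) (Eventually.of_forall fun x => ?_)
  rw [Real.norm_of_nonneg (sq_nonneg _)]; nlinarith [sq_nonneg (dX u x t)]
lemma int1 (h : St S P K u t) : IntegrableOn (fun x => (dX u x t)^2) (Ioi 0) := by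
  have c0 := h.sm.dx.contX t
  refine Integrable.mono' h.int (by fun_prop) (Eventually.of_forall fun x => ?_)
  rw [Real.norm_of_nonneg (sq_nonneg _)]; nlinarith [sq_nonneg (u x t)]
lemma int3 (h : St S P K u t) : IntegrableOn (fun x => (u x t)^3) (Ioi 0) := by
  have c0 := h.sm.contX t
  refine Integrable.mono' (h.int0.const_mul S) (by fun_prop) ?_
  filter_upwards [ae_restrict_mem measurableSet_Ioi] with x hx
  have := h.sup (le_of_lt hx)
  rw [Real.norm_eq_abs, pow_succ', abs_mul, abs_of_nonneg (sq_nonneg (u x t))]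
  exact mul_le_mul_of_nonneg_right this (sq_nonneg _)
end St

def Qc (c S P K : ℝ) : ℝ := (c + 1) * S + P + K
def Gc (c S : ℝ) : ℝ := 2 * (2 * c + c * S)^2 + 2 * S^2 + 9 * c^2
def eta (a : ℝ → ℝ) (u : ℝ → ℝ → ℝ) (Λ t : ℝ) : ℝ :=
  Real.sqrt (∫ x in (0:ℝ)..Λ, ((cF1 a u x t)^2 + (cF2 a u x t)^2))

section
variable {S P K c : ℝ} {u : ℝ → ℝ → ℝ} {t : ℝ} {a : ℕ → ℝ → ℝ}

lemma srcBd (A : Cut c a) (h : St S P K u t) (n : ℕ) {x : ℝ} (hx : 0 ≤ x) :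
    (cF1 (a n) u x t)^2 + (cF2 (a n) u x t)^2 ≤ Gc c S * ((u x t)^2 + (dX u x t)^2) := by
  have hc := A.hc
  have hS := h.hS
  have s := h.sup hx
  have a0 := A.n0 n x
  have a1 := A.n1 n x
  have b1 := A.b1' n x
  have b3 := A.b3' n x
  have f1 : |cF1 (a n) u x t| ≤ (2 * c + c * S) * |u x t| + S * |dX u x t| := by
    unfold cF1
    have e1 : |deriv (a n) x * u x t| ≤ c * |u x t| := by rw [abs_mul]; gcongr
    have e2 : |deriv (deriv (deriv (a n))) x * u x t| ≤ c * |u x t| := by rw [abs_mul]; gcongr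
    have e3 : |((a n x)^2 - a n x) * (u x t * dX u x t)| ≤ S * |dX u x t| := by
      rw [abs_mul, abs_mul]
      have : |(a n x)^2 - a n x| ≤ 1 := by rw [abs_le]; constructor <;> nlinarith
      calc _ ≤ 1 * (S * |dX u x t|) := by gcongr
        _ = _ := by ring
    have e4 : |a n x * deriv (a n) x * (u x t)^2| ≤ c * S * |u x t| := by
      rw [abs_mul, abs_mul, abs_pow, abs_of_nonneg a0]
      calc _ ≤ 1 * c * (S * |u x t|) := by
            rw [pow_two]; gcongr
        _ = _ := by ring
    refine (abs_add_le _ _).trans ?_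
    refine (add_le_add_left ((abs_add_le _ _).trans (add_le_add_left (abs_add_le _ _) _)) _).trans ?_
    linarith
  have f2 : |cF2 (a n) u x t| ≤ 3 * c * |dX u x t| := by
    unfold cF2
    rw [abs_mul, abs_mul, abs_of_pos (by norm_num : (0:ℝ) < 3), mul_assoc]
    gcongr
  have g1 := pow_le_pow_left₀ (abs_nonneg _) f1 2
  have g2 := pow_le_pow_left₀ (abs_nonneg _) f2 2
  rw [sq_abs] at g1 g2
  have u2 := sq_abs (u x t)
  have v2 := sq_abs (dX u x t)
  unfold Gc
  have k1 : ((2 * c + c * S) * |u x t| + S * |dX u x t|)^2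
      ≤ 2 * (2 * c + c * S)^2 * (u x t)^2 + 2 * S^2 * (dX u x t)^2 := by
    rw [← u2, ← v2]
    nlinarith [sq_nonneg ((2 * c + c * S) * |u x t| - S * |dX u x t|)]
  have k2 : (3 * c * |dX u x t|)^2 = 9 * c^2 * (dX u x t)^2 := by rw [← v2]; ring
  have p1 : 0 ≤ (2 * S^2 + 9 * c^2) * (u x t)^2 := by positivity
  have p2 : 0 ≤ 2 * (2 * c + c * S)^2 * (dX u x t)^2 := by positivity
  nlinarith

lemma etaSq (A : Cut c a) (hu : Sm u) (n : ℕ) {Λ : ℝ} (hΛ : 0 ≤ Λ) :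
    (eta (a n) u Λ t)^2 = (∫ x in (0:ℝ)..Λ, (cF1 (a n) u x t)^2) + ∫ x in (0:ℝ)..Λ, (cF2 (a n) u x t)^2 := by
  have c1 := (cF1_sm (A.sm n) hu).contX t
  have c2 := (cF2_sm (A.sm n) hu).contX t
  rw [eta, Real.sq_sqrt (intNonneg hΛ fun x _ => by positivity)]
  exact intAdd (by fun_prop) (by fun_prop)

lemma etaBd (A : Cut c a) (h : St S P K u t) (n : ℕ) {Λ : ℝ} (hΛ : 0 ≤ Λ) :
    eta (a n) u Λ t ≤ Real.sqrt (Gc c S * S^2) := by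
  have c1 := (cF1_sm (A.sm n) h.sm).contX t
  have c2 := (cF2_sm (A.sm n) h.sm).contX t
  have c3 := h.sm.contX t
  have c4 := h.sm.dx.contX t
  apply Real.sqrt_le_sqrt
  refine (intMono hΛ (by fun_prop) (g := fun x => Gc c S * ((u x t)^2 + (dX u x t)^2)) (by fun_prop)
    fun x hx => srcBd A h n hx.1).trans ?_
  rw [intMulC]
  exact mul_le_mul_of_nonneg_left (h.bd Λ hΛ) (by unfold Gc; positivity)

lemma etaLim (A : Cut c a) (h : St S P K u t) :
    Tendsto (fun n : ℕ => eta (a n) u (2 * ((n:ℝ)+1)) t) atTop (nhds 0) := by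
  have key := dctLim (F := fun n x => (cF1 (a n) u x t)^2 + (cF2 (a n) u x t)^2) (f := fun _ => 0)
    (g := fun x => Gc c S * ((u x t)^2 + (dX u x t)^2)) (h.int.const_mul _)
    (fun n => by
      have c1 := (cF1_sm (A.sm n) h.sm).contX t
      have c2 := (cF2_sm (A.sm n) h.sm).contX t
      fun_prop) (fun n x hx => by
        rw [abs_of_nonneg (by positivity)]; exact srcBd A h n hx.le) (fun x hx => by
        unfold cF1 cF2
        have t0 := A.t0 x
        have t1 := A.t1 x
        have t3 := A.t3 x
        have := ((((t1.mul_const (u x t)).add (t3.mul_const (u x t))).add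
          (((t0.pow 2).sub t0).mul_const (u x t * dX u x t))).add
          ((t0.mul t1).mul_const ((u x t)^2))).pow 2 |>.add
          (((t1.mul_const (dX u x t)).const_mul 3).pow 2)
        simpa using this)
  have := (Real.continuous_sqrt.tendsto _).comp key
  simpa [eta, Function.comp_def] using this

lemma etaCont (A : Cut c a) (hu : Sm u) (n : ℕ) (Λ : ℝ) : Continuous (fun t => eta (a n) u Λ t) := by
  have hf : Sm (fun x t => (cF1 (a n) u x t)^2 + (cF2 (a n) u x t)^2) :=
    ((cF1_sm (A.sm n) hu).pow 2).add ((cF2_sm (A.sm n) hu).pow 2)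
  exact Real.continuous_sqrt.comp
    (intervalIntegral.continuous_parametric_intervalIntegral_of_continuous'
      (f := fun t x => (cF1 (a n) u x t)^2 + (cF2 (a n) u x t)^2)
      (hf.cont.comp continuous_swap) _ _)

lemma cU1_zero (A : Cut c a) (h : St S P K u t) (n : ℕ) : dX (cU (a n) u) 0 t = dX u 0 t := by
  rw [cU_x (A.sm n) h.sm]
  simp only [h.bc, A.one n 0 (by positivity)]; ring

lemma cU_abs (A : Cut c a) (n : ℕ) (x : ℝ) : |cU (a n) u x t| ≤ |u x t| := by
  unfold cU
  rw [abs_mul, abs_of_nonneg (A.n0 n x)]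
  exact mul_le_of_le_one_left (abs_nonneg _) (A.n1 n x)

lemma cU1_sq (A : Cut c a) (hu : Sm u) (n : ℕ) (x : ℝ) :
    (dX (cU (a n) u) x t)^2 ≤ (c + 1)^2 * ((u x t)^2 + (dX u x t)^2) := by
  rw [cU_x (A.sm n) hu]
  have hc := A.hc
  have a0 := A.n0 n x
  have a1 := A.n1 n x
  have b1 := A.b1' n x
  have q1 : (deriv (a n) x)^2 ≤ c^2 := by rw [← sq_abs]; exact pow_le_pow_left₀ (abs_nonneg _) b1 2
  have q2 : (a n x)^2 ≤ 1 := by nlinarith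
  have k : (deriv (a n) x * u x t + a n x * dX u x t)^2
      ≤ ((deriv (a n) x)^2 + (a n x)^2) * ((u x t)^2 + (dX u x t)^2) := by
    nlinarith [sq_nonneg (deriv (a n) x * dX u x t - a n x * u x t)]
  refine k.trans ?_
  apply mul_le_mul_of_nonneg_right _ (by positivity)
  nlinarith

lemma cutBd (A : Cut c a) (h : St S P K u t) (n : ℕ) :
    Bd (2 * ((n:ℝ)+1)) (Qc c S P K) (eta (a n) u (2 * ((n:ℝ)+1)) t) (fun x => cU (a n) u x t)
      (fun x => dX (cU (a n) u) x t) (fun x => cF1 (a n) u x t) (fun x => cF2 (a n) u x t) := by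
  have hc := A.hc
  have hS := h.hS
  have hP := h.hP
  have hK := h.hK
  have hL : (0:ℝ) ≤ 2 * ((n:ℝ)+1) := by positivity
  have q1 : (c + 1) * S ≤ Qc c S P K := by unfold Qc; linarith
  have q1' : S ≤ Qc c S P K := by nlinarith
  have q0 : 0 ≤ Qc c S P K := by nlinarith
  have c3 := h.sm.contX t
  have c4 := h.sm.dx.contX t
  have c5 := (cU_sm (A.sm n) h.sm).contX t
  have c6 := (cU_sm (A.sm n) h.sm).dx.contX t
  have e := etaSq (t := t) A h.sm n hL
  have n1 : 0 ≤ ∫ x in (0:ℝ)..(2 * ((n:ℝ)+1)), (cF1 (a n) u x t)^2 := intNonneg hL fun x _ => by positivity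
  have n2 : 0 ≤ ∫ x in (0:ℝ)..(2 * ((n:ℝ)+1)), (cF2 (a n) u x t)^2 := intNonneg hL fun x _ => by positivity
  refine ⟨by linarith, Real.sqrt_nonneg _, ?_, ?_, ?_, ?_, ?_, by linarith, by linarith⟩
  · refine (intMono hL (by fun_prop) (g := fun x => (u x t)^2 + (dX u x t)^2) (by fun_prop)
      fun x hx => ?_).trans ((h.bd _ hL).trans (by gcongr))
    have := sq_le_sq.2 (cU_abs (u := u) (t := t) A n x)
    nlinarith [sq_nonneg (dX u x t)]
  · refine (intMono hL (by fun_prop) (g := fun x => (c+1)^2 * ((u x t)^2 + (dX u x t)^2)) (by fun_prop)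
      fun x hx => cU1_sq A h.sm n x).trans ?_
    rw [intMulC]
    calc _ ≤ (c+1)^2 * S^2 := mul_le_mul_of_nonneg_left (h.bd _ hL) (by positivity)
      _ = ((c+1)*S)^2 := by ring
      _ ≤ _ := by gcongr
  · intro x hx
    exact (cU_abs A n x).trans ((h.sup hx.1).trans q1')
  · intro x hx
    refine (cU_abs A n x).trans ?_
    rcases le_total x 1 with h1 | h1
    · have := h.tay x ⟨hx.1, h1⟩
      have k : |u x t| ≤ |u x t - dX u 0 t * x| + |dX u 0 t * x| := by
        have := abs_add_le (u x t - dX u 0 t * x) (dX u 0 t * x)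
        simpa using this
      rw [abs_mul, abs_of_nonneg hx.1] at k
      have k2 : |dX u 0 t| * x ≤ P * x := mul_le_mul_of_nonneg_right h.hp hx.1
      have k3 : K * x^2 ≤ K * x := by nlinarith [mul_nonneg hK hx.1, hx.1]
      have : (P + K) * x ≤ Qc c S P K * x := by
        apply mul_le_mul_of_nonneg_right _ hx.1
        unfold Qc; nlinarith
      nlinarith
    · refine (h.sup hx.1).trans (q1'.trans ?_)
      nlinarith
  · show |dX (cU (a n) u) 0 t| ≤ _
    rw [cU1_zero A h n]
    refine h.hp.trans ?_
    unfold Qc; nlinarith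

lemma cutTay (A : Cut c a) (h : St S P K u t) (n : ℕ) :
    ∀ x ∈ Icc (0:ℝ) (2 * ((n:ℝ)+1)), |cU (a n) u x t - dX (cU (a n) u) 0 t * x|
      ≤ K * x^2 + (S + P) * x^3 := by
  intro x hx
  have hS := h.hS
  have hP := h.hP
  have hK := h.hK
  rw [cU1_zero A h n]
  rcases le_total x 1 with h1 | h1
  · have e : cU (a n) u x t = u x t := by
      simp [cU, A.one n x (by linarith [n.cast_nonneg (α := ℝ)])]
    rw [e]
    have := h.tay x ⟨hx.1, h1⟩
    have : 0 ≤ (S + P) * x^3 := mul_nonneg (by linarith) (pow_nonneg hx.1 3)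
    linarith
  · refine (abs_sub _ _).trans ?_
    rw [abs_mul, abs_of_nonneg hx.1]
    have b1 := (cU_abs (u := u) (t := t) A n x).trans (h.sup hx.1)
    have b2 : |dX u 0 t| * x ≤ P * x := mul_le_mul_of_nonneg_right h.hp hx.1
    have x3 : 1 ≤ x^3 := one_le_pow₀ h1
    have x3' : x ≤ x^3 := by nlinarith [pow_two x, mul_nonneg hx.1 hx.1]
    have : P * x ≤ P * x^3 := by gcongr
    have : S ≤ S * x^3 := by nlinarith
    have : 0 ≤ K * x^2 := by positivity
    linarith
end

def MM (u : ℝ → ℝ → ℝ) (t : ℝ) : ℝ := ∫ x in Ioi (0:ℝ), (u x t)^2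
def EE (u : ℝ → ℝ → ℝ) (t : ℝ) : ℝ := (∫ x in Ioi (0:ℝ), (dX u x t)^2) - 1/3 * ∫ x in Ioi (0:ℝ), (u x t)^3

section
variable {S P K c : ℝ} {u : ℝ → ℝ → ℝ} {t : ℝ} {a : ℕ → ℝ → ℝ}

lemma limM (A : Cut c a) (h : St S P K u t) :
    Tendsto (fun n : ℕ => ∫ x in (0:ℝ)..(2 * ((n:ℝ)+1)), (cU (a n) u x t)^2) atTop (nhds (MM u t)) := by
  refine dctLim (g := fun x => (u x t)^2) h.int0 (fun n => ?_) (fun n x hx => ?_) (fun x hx => ?_)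
  · have c5 := (cU_sm (A.sm n) h.sm).contX t
    fun_prop
  · rw [abs_of_nonneg (sq_nonneg _)]
    exact sq_le_sq.2 (cU_abs A n x)
  · unfold cU
    simpa using ((A.t0 x).mul_const (u x t)).pow 2

lemma limC (A : Cut c a) (h : St S P K u t) :
    Tendsto (fun n : ℕ => ∫ x in (0:ℝ)..(2 * ((n:ℝ)+1)), (cU (a n) u x t)^3) atTop
      (nhds (∫ x in Ioi (0:ℝ), (u x t)^3)) := by
  refine dctLim (g := fun x => |(u x t)^3|) h.int3.abs (fun n => ?_) (fun n x hx => ?_) (fun x hx => ?_)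
  · have c5 := (cU_sm (A.sm n) h.sm).contX t
    fun_prop
  · rw [abs_pow, abs_pow]
    exact pow_le_pow_left₀ (abs_nonneg _) (cU_abs A n x) 3
  · unfold cU
    simpa using ((A.t0 x).mul_const (u x t)).pow 3

lemma limDt (A : Cut c a) (hu : Sm u) (x : ℝ) :
    Tendsto (fun n : ℕ => dX (cU (a n) u) x t) atTop (nhds (dX u x t)) := by
  have : (fun n : ℕ => dX (cU (a n) u) x t) = fun n => deriv (a n) x * u x t + a n x * dX u x t := by
    funext n; rw [cU_x (A.sm n) hu]
  rw [this]
  simpa using ((A.t1 x).mul_const (u x t)).add ((A.t0 x).mul_const (dX u x t))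

lemma limD (A : Cut c a) (h : St S P K u t) :
    Tendsto (fun n : ℕ => ∫ x in (0:ℝ)..(2 * ((n:ℝ)+1)), (dX (cU (a n) u) x t)^2) atTop
      (nhds (∫ x in Ioi (0:ℝ), (dX u x t)^2)) := by
  refine dctLim (g := fun x => (c+1)^2 * ((u x t)^2 + (dX u x t)^2)) (h.int.const_mul _)
    (fun n => ?_) (fun n x hx => ?_) (fun x hx => ?_)
  · have c5 := (cU_sm (A.sm n) h.sm).dx.contX t
    fun_prop
  · rw [abs_of_nonneg (sq_nonneg _)]
    exact cU1_sq A h.sm n x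
  · exact (limDt A h.sm x).pow 2

lemma cutSq (A : Cut c a) (m : ℕ) (x : ℝ) : (dX u x t - a m x * dX u x t)^2 ≤ (dX u x t)^2 := by
  have a0 := A.n0 m x
  have a1 := A.n1 m x
  have : (dX u x t - a m x * dX u x t)^2 = (1 - a m x)^2 * (dX u x t)^2 := by ring
  rw [this]
  exact mul_le_of_le_one_left (sq_nonneg _) (by nlinarith)

lemma limK (A : Cut c a) (h : St S P K u t) (m : ℕ) :
    Tendsto (fun n : ℕ => ∫ x in (0:ℝ)..(2 * ((n:ℝ)+1)), (dX (cU (a n) u) x t - a m x * dX u x t)^2) atTop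
      (nhds (∫ x in Ioi (0:ℝ), (dX u x t - a m x * dX u x t)^2)) := by
  refine dctLim (g := fun x => 2 * ((c+1)^2 * ((u x t)^2 + (dX u x t)^2)) + 2 * (dX u x t)^2)
    (Integrable.congr (((h.int.const_mul ((c+1)^2)).const_mul 2).add (h.int1.const_mul 2))
      (Eventually.of_forall fun x => rfl))
    (fun n => ?_) (fun n x hx => ?_) (fun x hx => ?_)
  · have c5 := (cU_sm (A.sm n) h.sm).dx.contX t
    have c6 := h.sm.dx.contX t
    have c7 := (A.sm m).continuous
    fun_prop
  · rw [abs_of_nonneg (sq_nonneg _)]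
    have := cU1_sq (t := t) A h.sm n x
    have a0 := A.n0 m x
    have a1 := A.n1 m x
    have k : (a m x * dX u x t)^2 ≤ (dX u x t)^2 := by
      rw [mul_pow]
      exact mul_le_of_le_one_left (sq_nonneg _) (by nlinarith)
    nlinarith [sq_nonneg (dX (cU (a n) u) x t + a m x * dX u x t)]
  · exact ((limDt A h.sm x).sub_const _).pow 2

lemma limK2 (A : Cut c a) (h : St S P K u t) :
    Tendsto (fun m : ℕ => ∫ x in Ioi (0:ℝ), (dX u x t - a m x * dX u x t)^2) atTop (nhds 0) := by
  have := tendsto_integral_of_dominated_convergence (μ := volume.restrict (Ioi (0:ℝ)))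
    (F := fun m x => (dX u x t - a m x * dX u x t)^2) (f := fun _ => 0) (fun x => (dX u x t)^2)
    (fun m => by
      have c6 := h.sm.dx.contX t
      have c7 := (A.sm m).continuous
      fun_prop) h.int1 (fun m => Eventually.of_forall fun x => by
      rw [Real.norm_of_nonneg (sq_nonneg _)]; exact cutSq A m x) (Eventually.of_forall fun x => by
      simpa using (((A.t0 x).mul_const (dX u x t)).const_sub (dX u x t)).pow 2)
  simpa using this

lemma staticLim (A : Cut c a) (h : St S P K u t) {Q : ℝ} (hQ : 1 ≤ Q) {δ : ℝ} (hδ : 0 < δ) :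
    ∃ ε0, 0 < ε0 ∧ ∀ ε, 0 < ε → ε < ε0 → ∀ᶠ n : ℕ in atTop, ∀ e : ℝ,
      (∀ (ψ ψ1 : ℝ → ℝ) (κ D : ℝ), (∀ x, HasDerivAt ψ (ψ1 x) x) → Continuous ψ1 →
          ψ (2 * ((n:ℝ)+1)) = 0 →
          0 ≤ κ → 0 ≤ D → ∫ x in (0:ℝ)..(2 * ((n:ℝ)+1)), (dX (cU (a n) u) x t - ψ x)^2 ≤ κ^2 →
          ∫ x in (0:ℝ)..(2 * ((n:ℝ)+1)), (ψ1 x)^2 ≤ D^2 →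
          |e - ((∫ x in (0:ℝ)..(2 * ((n:ℝ)+1)), (dX (cU (a n) u) x t)^2)
            - 1/3 * ∫ x in (0:ℝ)..(2 * ((n:ℝ)+1)), (cU (a n) u x t)^3)|
            ≤ 3 * Q^3 * ε + Q * (6 * κ + 4 * (ε * D))) → |e - EE u t| ≤ δ := by
  have hQ0 : 0 < Q := by linarith
  set κ := δ / (24 * Q) with hκ
  have κ0 : 0 < κ := by positivity
  have hκQ : Q * (6 * κ) = δ / 4 := by rw [hκ]; field_simp; norm_num
  obtain ⟨m, hm⟩ := ((limK2 A h).eventually_lt_const (by positivity : (0:ℝ) < κ^2)).exists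
  have e1 := (limK A h m).eventually_lt_const hm
  let ψ1 : ℝ → ℝ := fun x => deriv (a m) x * dX u x t + a m x * dX (dX u) x t
  have cψ : Continuous ψ1 := by
    have := (smD (A.sm m)).continuous
    have := (A.sm m).continuous
    have := h.sm.dx.contX t
    have := h.sm.dx.dx.contX t
    fun_prop
  have hψ : ∀ x, HasDerivAt (fun x => a m x * dX u x t) (ψ1 x) x := fun x =>
    (hasA (A.sm m) x).mul (h.sm.dx.hasX x t)
  have zψ : ∀ x, 2 * ((m:ℝ)+1) ≤ x → ψ1 x = 0 := by
    intro x hx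
    have v : Vn (2 * ((m:ℝ)+1)) (dX (cU (a m) (dX u))) := Vn.dx (cU_sm (A.sm m) h.sm.dx) (cU_v (A.zero m))
    have := v x t hx
    rw [cU_x (A.sm m) h.sm.dx] at this
    exact this
  set D := Real.sqrt (∫ x in (0:ℝ)..(2 * ((m:ℝ)+1)), (ψ1 x)^2) with hD
  have D0 : 0 ≤ D := Real.sqrt_nonneg _
  have D2 : D^2 = ∫ x in (0:ℝ)..(2 * ((m:ℝ)+1)), (ψ1 x)^2 :=
    Real.sq_sqrt (intNonneg (by positivity) fun x _ => sq_nonneg _)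
  have e2 : Tendsto (fun n : ℕ => (∫ x in (0:ℝ)..(2 * ((n:ℝ)+1)), (dX (cU (a n) u) x t)^2)
            - 1/3 * ∫ x in (0:ℝ)..(2 * ((n:ℝ)+1)), (cU (a n) u x t)^3) atTop (nhds (EE u t)) :=
    (limD A h).sub ((limC A h).const_mul (1/3))
  have e3 := (Metric.tendsto_nhds.1 e2) (δ/4) (by positivity)
  refine ⟨δ / (4 * (3 * Q^3 + 4 * Q * D)), by positivity, fun ε hε hε0 => ?_⟩
  filter_upwards [e1, e3, eventually_ge_atTop m] with n h1 h3 hn e he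
  have hn' : (m:ℝ) ≤ n := by exact_mod_cast hn
  have := he (fun x => a m x * dX u x t) ψ1 κ D hψ cψ
    (by simp only [A.zero m (2 * ((n:ℝ)+1)) (by linarith), zero_mul]) κ0.le D0 h1.le (by
      have cψ2 : Continuous fun x => (ψ1 x)^2 := cψ.pow 2
      rw [D2, ← intervalIntegral.integral_add_adjacent_intervals (b := 2 * ((m:ℝ)+1))
        (cψ2.intervalIntegrable _ _) (cψ2.intervalIntegrable _ _)]
      have z : ∫ x in (2 * ((m:ℝ)+1))..(2 * ((n:ℝ)+1)), (ψ1 x)^2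
          = ∫ x in (2 * ((m:ℝ)+1))..(2 * ((n:ℝ)+1)), (0:ℝ) := by
        apply intervalIntegral.integral_congr
        intro x hx
        rw [uIcc_of_le (by linarith)] at hx
        simp only [zψ x hx.1]; norm_num
      have z' : ∫ x in (2 * ((m:ℝ)+1))..(2 * ((n:ℝ)+1)), (ψ1 x)^2 = 0 := by rw [z]; simp
      show (∫ x in (0:ℝ)..(2 * ((m:ℝ)+1)), (ψ1 x)^2) + (∫ x in (2 * ((m:ℝ)+1))..(2 * ((n:ℝ)+1)), (ψ1 x)^2) ≤ _
      rw [z', add_zero])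
  rw [Real.dist_eq] at h3
  have hε' : ε * (3 * Q^3 + 4 * Q * D) ≤ δ / 4 := by
    have pos : 0 < 3 * Q^3 + 4 * Q * D := by positivity
    have := mul_le_mul_of_nonneg_right hε0.le pos.le
    have e : δ / (4 * (3 * Q^3 + 4 * Q * D)) * (3 * Q^3 + 4 * Q * D) = δ / 4 := by field_simp
    linarith
  have tri := abs_add_le (e - ((∫ x in (0:ℝ)..(2 * ((n:ℝ)+1)), (dX (cU (a n) u) x t)^2)
            - 1/3 * ∫ x in (0:ℝ)..(2 * ((n:ℝ)+1)), (cU (a n) u x t)^3))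
    (((∫ x in (0:ℝ)..(2 * ((n:ℝ)+1)), (dX (cU (a n) u) x t)^2)
            - 1/3 * ∫ x in (0:ℝ)..(2 * ((n:ℝ)+1)), (cU (a n) u x t)^3) - EE u t)
  rw [sub_add_sub_cancel] at tri
  nlinarith
end

/-- integrate a differential inequality -/
lemma growth {f f' η : ℝ → ℝ} (hd : ∀ t, HasDerivAt f (f' t) t) (hc : Continuous f')
    (hη : Continuous η) {t1 t2 α β : ℝ} (h12 : t1 ≤ t2)
    (h : ∀ t ∈ Icc t1 t2, f' t ≤ α + β * η t) :
    f t2 - f t1 ≤ α * (t2 - t1) + β * ∫ t in t1..t2, η t := by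
  rw [← intervalIntegral.integral_eq_sub_of_hasDerivAt (fun x _ => hd x) (hc.intervalIntegrable _ _)]
  have cc : Continuous fun t => α + β * η t := by fun_prop
  have := intervalIntegral.integral_mono_on (μ := volume) h12 (hc.intervalIntegrable _ _)
    (cc.intervalIntegrable t1 t2) h
  refine this.trans (le_of_eq ?_)
  rw [intervalIntegral.integral_add (by simp) ((hη.const_mul β).intervalIntegrable _ _)]
  simp
  ring

section
variable {S P K c : ℝ} {u : ℝ → ℝ → ℝ} {a : ℕ → ℝ → ℝ}

lemma etaInt (A : Cut c a) {t1 t2 : ℝ} (h12 : t1 ≤ t2) (h : ∀ t ∈ Icc t1 t2, St S P K u t) :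
    Tendsto (fun n : ℕ => ∫ t in t1..t2, eta (a n) u (2 * ((n:ℝ)+1)) t) atTop (nhds 0) := by
  have hu : Sm u := (h t1 (left_mem_Icc.2 h12)).sm
  have := intervalIntegral.tendsto_integral_filter_of_dominated_convergence (μ := volume) (a := t1) (b := t2)
    (l := atTop) (F := fun (n : ℕ) t => eta (a n) u (2 * ((n:ℝ)+1)) t) (f := fun _ => 0)
    (fun _ => Real.sqrt (Gc c S * S^2))
    (Eventually.of_forall fun n => (etaCont A hu n _).aestronglyMeasurable)
    (Eventually.of_forall fun n => Eventually.of_forall fun t ht => by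
      rw [uIoc_of_le h12] at ht
      rw [Real.norm_eq_abs, abs_of_nonneg (by unfold eta; positivity)]
      exact etaBd A (h t ⟨ht.1.le, ht.2⟩) n (by positivity))
    (by simp) (Eventually.of_forall fun t ht => by
      rw [uIoc_of_le h12] at ht
      exact etaLim A (h t ⟨ht.1.le, ht.2⟩))
  simpa using this

lemma lemmaA {t1 t2 : ℝ} (h12 : t1 ≤ t2) (h : ∀ t ∈ Icc t1 t2, St S P K u t)
    (hpde : ∀ t ∈ Icc t1 t2, ∀ x, 0 ≤ x →
      dT u x t + dX u x t + dX (dX (dX u)) x t + u x t * dX u x t = 0) :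
    MM u t2 ≤ MM u t1 ∧ EE u t2 ≤ EE u t1 ∧
    MM u t1 - P^2 * (t2 - t1) ≤ MM u t2 ∧
    EE u t1 - ((P+1)^2 + (2*K+1)^2) * (t2 - t1) ≤ EE u t2 := by
  obtain ⟨c, a, A⟩ := cutEx
  have hu : Sm u := (h t1 (left_mem_Icc.2 h12)).sm
  have ha := h t1 (left_mem_Icc.2 h12)
  have hb := h t2 (right_mem_Icc.2 h12)
  have hS := ha.hS
  have hP := ha.hP
  have hK := ha.hK
  set Q := Qc c S P K with hQdef
  have hQ : 1 ≤ Q := (cutBd A ha 0).hQ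
  have hL : ∀ n : ℕ, (1:ℝ) ≤ 2 * ((n:ℝ)+1) := fun n => by linarith [n.cast_nonneg (α := ℝ)]
  have ev := fun (ε : ℝ) (h1 : 0 < ε) (h2 : ε ≤ 1) (n : ℕ) =>
    evolution h1 h2 (hL n) (cU_sm (A.sm n) hu) (cF1_sm (A.sm n) hu) (cF2_sm (A.sm n) hu)
      (cU_v (A.zero n)) (cF2_v (A.sm n) (A.zero n)) (I := Icc t1 t2)
      (fun t ht => by simp [cU, (h t ht).bc])
      (fun t ht x hx => cut_pde (A.sm n) hu (hpde t ht x hx.1))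
  have ηl := etaInt A h12 h
  have hd : 0 ≤ t2 - t1 := by linarith
  -- mass
  have mass : ∀ n : ℕ,
      (∫ x in (0:ℝ)..(2 * ((n:ℝ)+1)), (cU (a n) u x t2)^2) - (∫ x in (0:ℝ)..(2 * ((n:ℝ)+1)), (cU (a n) u x t1)^2)
        ≤ 0 * (t2 - t1) + 4 * Q * ∫ t in t1..t2, eta (a n) u (2 * ((n:ℝ)+1)) t ∧
      (- ∫ x in (0:ℝ)..(2 * ((n:ℝ)+1)), (cU (a n) u x t2)^2) - (- ∫ x in (0:ℝ)..(2 * ((n:ℝ)+1)), (cU (a n) u x t1)^2)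
        ≤ P^2 * (t2 - t1) + 4 * Q * ∫ t in t1..t2, eta (a n) u (2 * ((n:ℝ)+1)) t := by
    intro n
    obtain ⟨E, m', e', cm, ce, dm, de, H⟩ := ev 1 one_pos le_rfl n
    constructor
    · refine growth dm cm (etaCont A hu n _) h12 fun t ht => ?_
      have := (abs_le.1 (H t ht Q _ (cutBd A (h t ht) n)).1).2
      nlinarith [sq_nonneg (dX (cU (a n) u) 0 t)]
    · refine growth (fun t => (dm t).neg) cm.neg (etaCont A hu n _) h12 fun t ht => ?_
      have := (abs_le.1 (H t ht Q _ (cutBd A (h t ht) n)).1).1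
      have p : (dX (cU (a n) u) 0 t)^2 ≤ P^2 := by
        rw [cU1_zero A (h t ht) n, ← sq_abs]
        exact pow_le_pow_left₀ (abs_nonneg _) (h t ht).hp 2
      linarith
  refine ⟨?_, ?_, ?_, ?_⟩
  · have := le_of_tendsto_of_tendsto' ((limM A hb).sub (limM A ha)) ((ηl.const_mul (4*Q)).const_add (0 * (t2-t1)))
      (fun n => (mass n).1)
    linarith
  · apply le_of_forall_pos_le_add
    intro δ hδ
    obtain ⟨ε1, p1, s1⟩ := staticLim A ha hQ (δ := δ/4) (by positivity)
    obtain ⟨ε2, p2, s2⟩ := staticLim A hb hQ (δ := δ/4) (by positivity)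
    obtain ⟨ε, hε, hlt⟩ := exists_between (a₁ := (0:ℝ))
      (a₂ := min (min ε1 ε2) (min 1 (δ / (4 * (14 * Q^4 * (t2 - t1) + 1))))) (by positivity)
    simp only [lt_min_iff] at hlt
    obtain ⟨⟨l1, l2⟩, l3, l4⟩ := hlt
    have l4' : ε * (14 * Q^4 * (t2 - t1) + 1) ≤ δ/4 := by
      have pos : 0 < 14 * Q^4 * (t2 - t1) + 1 := by positivity
      have := mul_le_mul_of_nonneg_right l4.le pos.le
      have e : δ / (4 * (14 * Q^4 * (t2 - t1) + 1)) * (14 * Q^4 * (t2 - t1) + 1) = δ / 4 := by field_simp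
      linarith
    have ηe := ((ηl.const_mul (16 * Q^2 / ε^3)).eventually_lt_const (u := δ/4) (by simpa using hδ))
    obtain ⟨n, i1, i2, i3⟩ := ((s1 ε hε l1).and ((s2 ε hε l2).and ηe)).exists
    obtain ⟨E, m', e', cm, ce, dm, de, H⟩ := ev ε hε l3.le n
    have j1 := abs_le.1 (i1 (E t1) (H t1 (left_mem_Icc.2 h12) Q _ (cutBd A ha n)).2.2.2)
    have j2 := abs_le.1 (i2 (E t2) (H t2 (right_mem_Icc.2 h12) Q _ (cutBd A hb n)).2.2.2)
    have g := growth de ce (etaCont A hu n _) (α := 14 * Q^4 * ε) (β := 16 * Q^2 / ε^3) h12 fun t ht => by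
      have := (H t ht Q _ (cutBd A (h t ht) n)).2.1
      refine this.trans (le_of_eq ?_); ring
    nlinarith
  · have := le_of_tendsto_of_tendsto' ((limM A hb).neg.sub (limM A ha).neg) ((ηl.const_mul (4*Q)).const_add (P^2 * (t2-t1)))
      (fun n => (mass n).2)
    linarith
  · apply le_of_forall_pos_le_add
    intro δ hδ
    obtain ⟨ε1, p1, s1⟩ := staticLim A ha hQ (δ := δ/4) (by positivity)
    obtain ⟨ε2, p2, s2⟩ := staticLim A hb hQ (δ := δ/4) (by positivity)
    have B0 : 0 < S + P := by linarith
    obtain ⟨ε, hε, hlt⟩ := exists_between (a₁ := (0:ℝ))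
      (a₂ := min (min ε1 ε2) (min (min 1 (1 / (2 * K + 6 * (S + P) + 1)))
        (δ / (4 * (14 * Q^4 * (t2 - t1) + 1))))) (by positivity)
    simp only [lt_min_iff] at hlt
    obtain ⟨⟨l1, l2⟩, ⟨l3, l5⟩, l4⟩ := hlt
    have l4' : ε * (14 * Q^4 * (t2 - t1) + 1) ≤ δ/4 := by
      have pos : 0 < 14 * Q^4 * (t2 - t1) + 1 := by positivity
      have := mul_le_mul_of_nonneg_right l4.le pos.le
      have e : δ / (4 * (14 * Q^4 * (t2 - t1) + 1)) * (14 * Q^4 * (t2 - t1) + 1) = δ / 4 := by field_simp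
      linarith
    have l5' : ε * (2 * K + 6 * (S + P) + 1) ≤ 1 := by
      have pos : 0 < 2 * K + 6 * (S + P) + 1 := by positivity
      rw [lt_div_iff₀ pos] at l5
      exact l5.le
    have Kε : 0 ≤ K * ε := by positivity
    have Bε : 0 ≤ (S + P) * ε := by positivity
    have r1 : 6 * (S + P) * ε ≤ 1 := by nlinarith
    have r2 : ε * (2 * K + 6 * (S + P) * ε) ≤ 1 := by nlinarith
    have ηe := ((ηl.const_mul (16 * Q^2 / ε^3)).eventually_lt_const (u := δ/4) (by simpa using hδ))
    obtain ⟨n, i1, i2, i3⟩ := ((s1 ε hε l1).and ((s2 ε hε l2).and ηe)).exists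
    obtain ⟨E, m', e', cm, ce, dm, de, H⟩ := ev ε hε l3.le n
    have j1 := abs_le.1 (i1 (E t1) (H t1 (left_mem_Icc.2 h12) Q _ (cutBd A ha n)).2.2.2)
    have j2 := abs_le.1 (i2 (E t2) (H t2 (right_mem_Icc.2 h12) Q _ (cutBd A hb n)).2.2.2)
    have g := growth (fun t => (de t).neg) ce.neg (etaCont A hu n _)
      (α := ((P+1)^2 + (2*K+1)^2) + 14 * Q^4 * ε) (β := 16 * Q^2 / ε^3) h12 fun t ht => by
      have hp : |dX (cU (a n) u) 0 t| ≤ P := by rw [cU1_zero A (h t ht) n]; exact (h t ht).hp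
      have := (H t ht Q _ (cutBd A (h t ht) n)).2.2.1 K (S + P) P hK (hp.trans (by linarith)) hp
        (cutTay A (h t ht) n)
      have q1 : (P + ε * (2 * K + 6 * (S + P) * ε))^2 ≤ (P+1)^2 := by gcongr
      have q2 : (2 * K + 6 * (S + P) * ε)^2 ≤ (2*K+1)^2 := by gcongr
      have q3 : 16 * Q^2 / ε^3 * eta (a n) u (2 * ((n:ℝ)+1)) t = 16 * Q^2 * eta (a n) u (2 * ((n:ℝ)+1)) t / ε^3 := by ring
      rw [q3]
      linarith
    have g' : -E t2 - -E t1 ≤ _ := g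
    nlinarith
end

lemma extendPde {T : ℝ} (hT : 0 < T) {u : ℝ → ℝ → ℝ} (hu : Sm u)
    (hpde : ∀ x ∈ Ioi (0:ℝ), ∀ t ∈ Ioo 0 T,
      dT u x t + dX u x t + dX (dX (dX u)) x t + u x t * dX u x t = 0) :
    ∀ t ∈ Icc 0 T, ∀ x, 0 ≤ x → dT u x t + dX u x t + dX (dX (dX u)) x t + u x t * dX u x t = 0 := by
  have hG : Sm (fun x t => dT u x t + dX u x t + dX (dX (dX u)) x t + u x t * dX u x t) :=
    ((hu.dt.add hu.dx).add hu.dx.dx.dx).add (hu.mul hu.dx)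
  have cl : IsClosed {p : ℝ × ℝ | dT u p.1 p.2 + dX u p.1 p.2 + dX (dX (dX u)) p.1 p.2
      + u p.1 p.2 * dX u p.1 p.2 = 0} := isClosed_eq hG.cont continuous_const
  have sub : Ioi (0:ℝ) ×ˢ Ioo 0 T ⊆ {p : ℝ × ℝ | dT u p.1 p.2 + dX u p.1 p.2 + dX (dX (dX u)) p.1 p.2
      + u p.1 p.2 * dX u p.1 p.2 = 0} := fun p hp => hpde p.1 hp.1 p.2 hp.2
  have := closure_minimal sub cl
  rw [closure_prod_eq, closure_Ioi, closure_Ioo hT.ne] at this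
  intro t ht x hx
  exact this (a := (x, t)) ⟨hx, ht⟩

lemma consts {T : ℝ} {u : ℝ → ℝ → ℝ} (hu : Sm u) (hbc : ∀ t ∈ Icc (0:ℝ) T, u 0 t = 0) :
    ∃ P K : ℝ, 0 ≤ P ∧ 0 ≤ K ∧ ∀ t ∈ Icc (0:ℝ) T, |dX u 0 t| ≤ P ∧
      ∀ x ∈ Icc (0:ℝ) 1, |u x t - dX u 0 t * x| ≤ K * x^2 := by
  obtain ⟨P, hP⟩ := (isCompact_Icc (a := (0:ℝ)) (b := T)).exists_bound_of_continuousOn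
    (hu.dx.contT 0).continuousOn
  obtain ⟨K, hK⟩ := ((isCompact_Icc (a := (0:ℝ)) (b := 1)).prod
    (isCompact_Icc (a := (0:ℝ)) (b := T))).exists_bound_of_continuousOn hu.dx.dx.cont.continuousOn
  refine ⟨|P|, |K|, abs_nonneg _, abs_nonneg _, fun t ht => ⟨(hP t ht).trans (le_abs_self P), fun x hx => ?_⟩⟩
  have h1 : ∀ y ∈ Icc (0:ℝ) 1, |dX u y t - dX u 0 t| ≤ |K| * y := by
    intro y hy
    have := (convex_Icc (0:ℝ) 1).norm_image_sub_le_of_norm_hasDerivWithin_le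
      (f := fun y => dX u y t) (f' := fun y => dX (dX u) y t) (C := |K|)
      (fun z _ => (hu.dx.hasX z t).hasDerivWithinAt) (fun z hz => (hK (z, t) ⟨hz, ht⟩).trans (le_abs_self K))
      (left_mem_Icc.2 zero_le_one) hy
    simpa [abs_of_nonneg hy.1] using this
  have h2 := (convex_Icc (0:ℝ) x).norm_image_sub_le_of_norm_hasDerivWithin_le
      (f := fun y => u y t - dX u 0 t * y) (f' := fun y => dX u y t - dX u 0 t) (C := |K| * x)
      (fun z _ => (((hu.hasX z t).sub ((hasDerivAt_id z).const_mul (dX u 0 t))).congr_deriv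
        (by simp)).hasDerivWithinAt)
      (fun z hz => (h1 z ⟨hz.1, hz.2.trans hx.2⟩).trans
        (mul_le_mul_of_nonneg_left hz.2 (abs_nonneg _)))
      (left_mem_Icc.2 hx.1) (right_mem_Icc.2 hx.1)
  simp only [hbc t ht, mul_zero, sub_zero, Real.norm_eq_abs, abs_of_nonneg hx.1] at h2
  refine h2.trans (le_of_eq ?_)
  ring

def NN (u : ℝ → ℝ → ℝ) (t : ℝ) : ℝ := ∫ x in Ioi (0:ℝ), ((u x t)^2 + (dX u x t)^2)
def DD (u : ℝ → ℝ → ℝ) (t : ℝ) : ℝ := ∫ x in Ioi (0:ℝ), (dX u x t)^2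

section
variable {S P K : ℝ} {u : ℝ → ℝ → ℝ} {t : ℝ}

lemma NN_eq (h : St S P K u t) : NN u t = MM u t + DD u t := integral_add h.int0 h.int1
lemma NN_eq2 (h : St S P K u t) : NN u t = MM u t + EE u t + 1/3 * ∫ x in Ioi (0:ℝ), (u x t)^3 := by
  rw [NN_eq h, DD, EE]; ring
lemma EE_eq : EE u t = DD u t - 1/3 * ∫ x in Ioi (0:ℝ), (u x t)^3 := rfl
lemma MM_nn : 0 ≤ MM u t := integral_nonneg fun x => sq_nonneg _
lemma DD_nn : 0 ≤ DD u t := integral_nonneg fun x => sq_nonneg _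
lemma NN_nn : 0 ≤ NN u t := integral_nonneg fun x => by positivity

lemma int_le_NN (hi : IntegrableOn (fun x => (u x t)^2 + (dX u x t)^2) (Ioi 0)) {R : ℝ} (hR : 0 ≤ R) :
    ∫ x in (0:ℝ)..R, ((u x t)^2 + (dX u x t)^2) ≤ NN u t := by
  rw [intervalIntegral.integral_of_le hR]
  exact setIntegral_mono_set hi (Eventually.of_forall fun x => by positivity)
    (Eventually.of_forall fun x hx => hx.1)

lemma NN_le (hi : IntegrableOn (fun x => (u x t)^2 + (dX u x t)^2) (Ioi 0)) {B : ℝ}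
    (h : ∀ R, 0 ≤ R → ∫ x in (0:ℝ)..R, ((u x t)^2 + (dX u x t)^2) ≤ B) : NN u t ≤ B := by
  refine le_of_tendsto (intervalIntegral_tendsto_integral_Ioi 0 hi tendsto_id) ?_
  filter_upwards [eventually_ge_atTop 0] with R hR using h R hR

lemma supNN (h : St S P K u t) {x : ℝ} (hx : 0 ≤ x) : |u x t| ≤ Real.sqrt (NN u t) :=
  Real.abs_le_sqrt ((sqLe h.sm h.bc hx).trans (int_le_NN h.int hx))

lemma cubeBd (h : St S P K u t) {s : ℝ} (hs : ∀ x, 0 ≤ x → |u x t| ≤ s) :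
    |∫ x in Ioi (0:ℝ), (u x t)^3| ≤ s * MM u t := by
  refine (abs_integral_le_integral_abs).trans ?_
  rw [MM, ← integral_const_mul]
  refine setIntegral_mono_on h.int3.abs (h.int0.const_mul s) measurableSet_Ioi fun x hx => ?_
  rw [pow_succ', abs_mul, abs_of_nonneg (sq_nonneg (u x t))]
  exact mul_le_mul_of_nonneg_right (hs x (le_of_lt hx)) (sq_nonneg _)
end

lemma bounded {T : ℝ} (hT : 0 < T) {u : ℝ → ℝ → ℝ} (hu : Sm u)
    {P K : ℝ} (hP : 0 ≤ P) (hK : 0 ≤ K)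
    (hbc : ∀ t ∈ Icc (0:ℝ) T, u 0 t = 0)
    (hPK : ∀ t ∈ Icc (0:ℝ) T, |dX u 0 t| ≤ P ∧
      ∀ x ∈ Icc (0:ℝ) 1, |u x t - dX u 0 t * x| ≤ K * x^2)
    (hpde : ∀ t ∈ Icc 0 T, ∀ x, 0 ≤ x →
      dT u x t + dX u x t + dX (dX (dX u)) x t + u x t * dX u x t = 0)
    (hi : ∀ t ∈ Icc 0 T, IntegrableOn (fun x => (u x t)^2 + (dX u x t)^2) (Ioi 0)) :
    ∃ S, ∀ t ∈ Icc 0 T, St S P K u t := by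
  let A : ℕ → Set ℝ := fun n => {t | ∀ R, 0 ≤ R → ∫ x in (0:ℝ)..R, ((u x t)^2 + (dX u x t)^2) ≤ n}
  have mkSt : ∀ n : ℕ, ∀ t ∈ Icc 0 T, t ∈ A n → St (Real.sqrt n + 1) P K u t := by
    intro n t ht hA
    refine ⟨by linarith [Real.sqrt_nonneg (n:ℝ)], hP, hK, hu, hbc t ht, fun R hR => (hA R hR).trans ?_,
      (hPK t ht).1, (hPK t ht).2⟩
    nlinarith [Real.sqrt_nonneg (n:ℝ), Real.sq_sqrt (n.cast_nonneg (α := ℝ))]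
  have hm : Monotone A := fun n m hnm t ht R hR => (ht R hR).trans (by exact_mod_cast hnm)
  have hc : ∀ n, IsClosed (A n) := by
    intro n
    have : A n = ⋂ R : ℝ, ⋂ _ : 0 ≤ R, {t | ∫ x in (0:ℝ)..R, ((u x t)^2 + (dX u x t)^2) ≤ n} := by
      ext t; simp [A]
    rw [this]
    refine isClosed_iInter fun R => isClosed_iInter fun _ => isClosed_le ?_ continuous_const
    have hf : Sm (fun x t => (u x t)^2 + (dX u x t)^2) := (hu.pow 2).add (hu.dx.pow 2)
    exact intervalIntegral.continuous_parametric_intervalIntegral_of_continuous'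
      (f := fun t x => (u x t)^2 + (dX u x t)^2) (hf.cont.comp continuous_swap) _ _
  set K0 : ℝ := (P+1)^2 + (2*K+1)^2 with hK0
  have K0P : P^2 ≤ K0 := by rw [hK0]; nlinarith
  have K00 : 0 ≤ K0 := by positivity
  let m : ℕ → ℝ := fun n => n + K0 * T
  let β : ℕ → ℝ := fun n => m n + (n + (Real.sqrt n + 1) * n / 3) + K0 * T
  obtain ⟨B, hB⟩ := baireBound (T := T) A hc hm (fun t ht => by
      refine ⟨⌈NN u t⌉₊, fun R hR => (int_le_NN (hi t ht) hR).trans (Nat.le_ceil _)⟩)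
    (fun n => ⌈2 * β n + (m n)^2 / 9⌉₊) (by
      rintro s hs t ht ⟨B, hB⟩ n htn
      have hsub : uIcc s t ⊆ Icc 0 T := by
        rw [← uIcc_of_le hT.le] at hs ht ⊢
        exact uIcc_subset_uIcc hs ht
      have hSt : ∀ r ∈ uIcc s t, St (Real.sqrt B + 1) P K u r := fun r hr => mkSt B r (hsub hr) (hB hr)
      have key : MM u s ≤ MM u t + K0 * T ∧ EE u s ≤ EE u t + K0 * T := by
        have pT : 0 ≤ K0 * T := by positivity
        rcases le_total s t with h | h
        · rw [uIcc_of_le h] at hSt hsub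
          obtain ⟨-, -, a3, a4⟩ := lemmaA h hSt (fun r hr => hpde r (hsub hr))
          have d1 : t - s ≤ T := by linarith [hs.1, ht.2]
          have d2 : 0 ≤ t - s := by linarith
          have : P^2 * (t - s) ≤ K0 * T := mul_le_mul K0P d1 d2 K00
          have : K0 * (t - s) ≤ K0 * T := mul_le_mul_of_nonneg_left d1 K00
          constructor <;> linarith
        · rw [uIcc_of_ge h] at hSt hsub
          obtain ⟨a1, a2, -, -⟩ := lemmaA h hSt (fun r hr => hpde r (hsub hr))
          constructor <;> linarith
      have St_t := mkSt n t ht htn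
      have St_s := hSt s left_mem_uIcc
      have Nt : NN u t ≤ n := NN_le (hi t ht) htn
      have e1 := NN_eq St_t
      have M0 : 0 ≤ MM u t := MM_nn
      have D0 : 0 ≤ DD u t := DD_nn
      have c1 := (abs_le.1 (cubeBd St_t (s := Real.sqrt n + 1) fun x hx => St_t.sup hx)).1
      have Et : EE u t ≤ n + (Real.sqrt n + 1) * n / 3 := by
        rw [EE_eq]
        have : (Real.sqrt n + 1) * MM u t ≤ (Real.sqrt n + 1) * n :=
          mul_le_mul_of_nonneg_left (by linarith) (by positivity)
        linarith
      have c2 := (abs_le.1 (cubeBd St_s (s := Real.sqrt (NN u s)) fun x hx => supNN St_s hx)).2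
      have e2 := NN_eq2 St_s
      have q0 := Real.sqrt_nonneg (NN u s)
      have q1 := Real.sq_sqrt (NN_nn (u := u) (t := s))
      have Ms : MM u s ≤ m n := by simp only [m]; linarith [key.1]
      have : Real.sqrt (NN u s) * MM u s ≤ Real.sqrt (NN u s) * m n := mul_le_mul_of_nonneg_left Ms q0
      have f1 : NN u s ≤ β n + Real.sqrt (NN u s) * m n / 3 := by simp only [β]; linarith [key.2]
      have f2 : NN u s ≤ 2 * β n + (m n)^2 / 9 := by
        nlinarith [sq_nonneg (Real.sqrt (NN u s) - m n / 3)]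
      intro R hR
      exact (int_le_NN (hi s hs) hR).trans (f2.trans (Nat.le_ceil _)))
  exact ⟨_, fun t ht => mkSt B t ht (hB ht)⟩

/-- Let `u` be a smooth decaying solution of `∂ₜ u + ∂ₓ u + ∂ₓ³ u + u ∂ₓ u = 0` on
`(0,∞) × (0,T)` with `u(0,t) = 0` and `u(·,0) = u₀ ∈ H¹(0,∞)`. Then, with `C` the
constant of the embedding `H¹(0,∞) ↪ L^∞(0,∞)` and `s = ‖u₀‖_{H¹(0,∞)}`, one has
`‖u(·,t)‖_{H¹(0,∞)} ≤ c(s) := √((C²/5)s⁴ + (2/5)s³ + (12/5)s²)` for all `t ∈ [0,T]`. -/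
theorem stmt_10 (T : ℝ) (hT : 0 < T) (C : ℝ) (hC0 : 0 < C)
    -- `C` is a constant for the Sobolev embedding `H¹(0,∞) ↪ L^∞(0,∞)`
    (hC : ∀ f : ℝ → ℝ, Differentiable ℝ f →
      IntegrableOn (fun x => (f x)^2 + (deriv f x)^2) (Ioi 0) →
      ∀ x ∈ Ici (0:ℝ), |f x| ≤ C * H1norm f)
    (u : ℝ → ℝ → ℝ) (u₀ : ℝ → ℝ)
    (hsmooth : ContDiff ℝ (⊤ : ℕ∞) (fun p : ℝ × ℝ => u p.1 p.2))
    (hpde : ∀ x ∈ Ioi (0:ℝ), ∀ t ∈ Ioo 0 T,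
      deriv (fun s => u x s) t + deriv (fun y => u y t) x
        + iteratedDeriv 3 (fun y => u y t) x
        + u x t * deriv (fun y => u y t) x = 0)
    (hbc : ∀ t ∈ Icc (0:ℝ) T, u 0 t = 0)
    (hinit : ∀ x, u x 0 = u₀ x)
    (hdecay0 : ∀ t ∈ Icc 0 T, Tendsto (fun x => u x t) atTop (nhds 0))
    (hdecay1 : ∀ t ∈ Icc 0 T, Tendsto (fun x => deriv (fun y => u y t) x) atTop (nhds 0))
    (hdecay2 : ∀ t ∈ Icc 0 T,
      Tendsto (fun x => iteratedDeriv 2 (fun y => u y t) x) atTop (nhds 0))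
    (hint : ∀ t ∈ Icc 0 T,
      IntegrableOn (fun x => (u x t)^2 + (deriv (fun y => u y t) x)^2) (Ioi 0)) :
    ∀ t ∈ Icc (0:ℝ) T,
      H1norm (fun x => u x t)
        ≤ Real.sqrt ((C^2 / 5) * (H1norm u₀)^4 + (2 / 5) * (H1norm u₀)^3
            + (12 / 5) * (H1norm u₀)^2) := by
  intro t ht
  have hu : Sm u := hsmooth
  have hpde0 : ∀ x ∈ Ioi (0:ℝ), ∀ t ∈ Ioo 0 T,
      dT u x t + dX u x t + dX (dX (dX u)) x t + u x t * dX u x t = 0 := by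
    intro x hx t ht
    have := hpde x hx t ht
    simp only [iteratedDeriv_succ, iteratedDeriv_zero] at this
    exact this
  have hpde' := extendPde hT hu hpde0
  obtain ⟨P, K, hP, hK, hPK⟩ := consts hu hbc
  obtain ⟨S, hS⟩ := bounded hT hu hP hK hbc hPK hpde' hint
  have hsub : Icc 0 t ⊆ Icc 0 T := Icc_subset_Icc_right ht.2
  obtain ⟨a1, a2, -, -⟩ := lemmaA ht.1 (fun r hr => hS r (hsub hr)) (fun r hr => hpde' r (hsub hr))
  have S0 := hS 0 ⟨le_rfl, hT.le⟩
  have S1 := hS t ht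
  have hu0 : u₀ = fun x => u x 0 := funext fun x => (hinit x).symm
  have h0 : H1norm u₀ = Real.sqrt (NN u 0) := by rw [hu0]; rfl
  have h1 : H1norm (fun x => u x t) = Real.sqrt (NN u t) := rfl
  have b0 := cubeBd S0 (s := Real.sqrt (NN u 0)) fun x hx => supNN S0 hx
  have b1 := cubeBd S1 (s := C * Real.sqrt (NN u t)) fun x hx =>
    hC (fun x => u x t) (fun x => (hu.hasX x t).differentiableAt) (hint t ht) x hx
  rw [h0, h1]
  set s := Real.sqrt (NN u 0) with hs
  set X := Real.sqrt (NN u t) with hX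
  have s0 : 0 ≤ s := Real.sqrt_nonneg _
  have X0 : 0 ≤ X := Real.sqrt_nonneg _
  have s2 : s^2 = NN u 0 := Real.sq_sqrt NN_nn
  have X2 : X^2 = NN u t := Real.sq_sqrt NN_nn
  have e0 := NN_eq2 S0
  have e0' := NN_eq S0
  have e1 := NN_eq2 S1
  have M0 : MM u 0 ≤ s^2 := by linarith [DD_nn (u := u) (t := 0)]
  have M1 : MM u t ≤ s^2 := a1.trans M0
  have c0 := (abs_le.1 b0).1
  have c1 := (abs_le.1 b1).2
  have d0 : s * MM u 0 ≤ s * s^2 := mul_le_mul_of_nonneg_left M0 s0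
  have d1 : C * X * MM u t ≤ C * X * s^2 := mul_le_mul_of_nonneg_left M1 (by positivity)
  apply Real.le_sqrt_of_sq_le
  nlinarith [sq_nonneg (X - C * s^2)]

end
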